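/- For every m ∈ (1,2], the critical base 𝓛(m) is given as follows: (i) 𝓛(m) = g_{σ(1 0̄)}(m) whenever σ ∈ {L,M,R}*M and m ∈ [μ_{σ(1 0̄)}, μ_{σ(01 0̄)}]; (ii) 𝓛(m) = f_{σ(0 1̄)}(m) whenever σ ∈ {L,M,R}*M and m ∈ [μ_{σ(10 1̄)}, μ_{σ(0 1̄)}]; (iii) 𝓛(m) = g_{0 1̄}(m) whenever m ∈ [μ_{0 1̄}, 2]; (iv) 𝓛(m) = f_u(m) whenever u ∈ S_{L,M,R} and m = μ_u. -/

import Mathlib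

/-- `π_β(u)` for a binary sequence `u = u₁u₂⋯` (indexed from 0). -/
noncomputable def piB (β : ℝ) (u : ℕ → Bool) : ℝ :=
  ∑' k : ℕ, (if u k then (1 : ℝ) else 0) / β ^ (k + 1)

/-- `π_β(u)` for a real digit sequence. -/
noncomputable def piR (β : ℝ) (u : ℕ → ℝ) : ℝ := ∑' k : ℕ, u k / β ^ (k + 1)

/-- A binary sequence viewed as a real digit sequence. -/
def bR (u : ℕ → Bool) : ℕ → ℝ := fun k => if u k then 1 else 0

/-- `U_β(A)`: sequences with digits in `A` whose `π_β`-value has no other expansion over `A`. -/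
def Uset (β : ℝ) (A : Set ℝ) : Set (ℕ → ℝ) :=
  {u | (∀ k, u k ∈ A) ∧ ∀ v : ℕ → ℝ, (∀ k, v k ∈ A) → v ≠ u → piR β v ≠ piR β u}

/-- `𝓛(m) = inf {β > 1 : U_β(m) ∩ {0,1}^ℕ is uncountable}`. -/
noncomputable def Lval (m : ℝ) : ℝ :=
  sInf {β : ℝ | 1 < β ∧ ¬ (Uset β {0, 1, m} ∩ {v | ∃ u : ℕ → Bool, v = bR u}).Countable}

/-- The shift orbit `O(u)` of an infinite binary word. -/
def orbit (u : ℕ → Bool) : Set (ℕ → Bool) := {v | ∃ k : ℕ, v = fun i => u (i + k)}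

/-- Suffixes of `u` preceded by the letter `1`. -/
def orbit1 (u : ℕ → Bool) : Set (ℕ → Bool) :=
  {v | ∃ k : ℕ, u k = true ∧ v = fun i => u (i + k + 1)}

/-- Suffixes of `u` preceded by the letter `0`. -/
def orbit0 (u : ℕ → Bool) : Set (ℕ → Bool) :=
  {v | ∃ k : ℕ, u k = false ∧ v = fun i => u (i + k + 1)}

open Classical in
/-- The lexicographic supremum of a set of binary sequences (greedy construction);
`⊥ = 0̄` for the empty set. -/
noncomputable def lexSupSeq (S : Set (ℕ → Bool)) : ℕ → Bool
  | n => decide (∃ u ∈ S, (∀ i, i < n → u i = lexSupSeq S i) ∧ u n = true)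
  termination_by n => n

open Classical in
/-- The lexicographic infimum of a set of binary sequences (greedy construction);
`⊤ = 1̄` for the empty set. -/
noncomputable def lexInfSeq (S : Set (ℕ → Bool)) : ℕ → Bool
  | n => decide (¬ ∃ u ∈ S, (∀ i, i < n → u i = lexInfSeq S i) ∧ u n = false)
  termination_by n => n

/-- `sup O(u)`, the lexicographically largest limit of suffixes of `u`. -/
noncomputable def supO (u : ℕ → Bool) : ℕ → Bool := lexSupSeq (orbit u)
/-- `inf O(u)`. -/
noncomputable def infO (u : ℕ → Bool) : ℕ → Bool := lexInfSeq (orbit u)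
/-- `sup₀(u)`, the supremum of the suffixes preceded by `0`. -/
noncomputable def sup0 (u : ℕ → Bool) : ℕ → Bool := lexSupSeq (orbit0 u)
/-- `inf₁(u)`, the infimum of the suffixes preceded by `1`. -/
noncomputable def inf1 (u : ℕ → Bool) : ℕ → Bool := lexInfSeq (orbit1 u)

/-- Strict lexicographic order on infinite binary words. -/
def lexLt (u v : ℕ → Bool) : Prop := ∃ n, (∀ i, i < n → u i = v i) ∧ u n < v n
/-- Lexicographic order on infinite binary words. -/
def lexLe (u v : ℕ → Bool) : Prop := lexLt u v ∨ u = v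

/-- `f_u(m)`: the unique `β ≥ 1` with `β·π_β(sup O(u)) = m`. -/
noncomputable def fVal (u : ℕ → Bool) (m : ℝ) : ℝ :=
  sInf {β : ℝ | 1 ≤ β ∧ β * piB β (supO u) = m}

/-- `g_u(m)`: the unique `β > 1` with `(β-1)(1+π_β(inf O(u))) = m`. -/
noncomputable def gVal (u : ℕ → Bool) (m : ℝ) : ℝ :=
  sInf {β : ℝ | 1 < β ∧ (β - 1) * (1 + piB β (infO u)) = m}

/-- `μ_u`: the unique `m ∈ (1,2]` with `f_u(m) = g_u(m)`. -/
noncomputable def muVal (u : ℕ → Bool) : ℝ :=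
  sInf {m : ℝ | 1 < m ∧ m ≤ 2 ∧ fVal u m = gVal u m}

/-- `u` contains at least two ones. -/
def TwoOnes (u : ℕ → Bool) : Prop := ∃ k l, k < l ∧ u k = true ∧ u l = true

/-- The substitution `L : 0 ↦ 0, 1 ↦ 01` (with `0 = false`, `1 = true`). -/
def Lsub : Bool → List Bool := fun b => if b then [false, true] else [false]
/-- The substitution `M : 0 ↦ 01, 1 ↦ 10`. -/
def Msub : Bool → List Bool := fun b => if b then [true, false] else [false, true]
/-- The substitution `R : 0 ↦ 01, 1 ↦ 1`. -/
def Rsub : Bool → List Bool := fun b => if b then [true] else [false, true]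
/-- The identity substitution. -/
def idSub : Bool → List Bool := fun b => [b]
/-- Composition of substitutions: `compSub σ τ = σ ∘ τ` (apply `τ` first). -/
def compSub (σ τ : Bool → List Bool) : Bool → List Bool := fun b => (τ b).flatMap σ

/-- The monoid `{L,M,R}*` generated by the three substitutions. -/
def LMRstar : Set (Bool → List Bool) :=
  {σ | ∃ l : List (Bool → List Bool),
    (∀ τ ∈ l, τ = Lsub ∨ τ = Msub ∨ τ = Rsub) ∧ σ = l.foldr compSub idSub}

/-- A substitution applied to an infinite word, `σ(u₁)σ(u₂)⋯`. -/
noncomputable def substApply (σ : Bool → List Bool) (u : ℕ → Bool) : ℕ → Bool := fun n =>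
  let k := sSup {k : ℕ | (∑ i ∈ Finset.range k, (σ (u i)).length) ≤ n}
  (σ (u k)).getD (n - ∑ i ∈ Finset.range k, (σ (u i)).length) false

/-- `u` is a limit word of the sequence of substitutions `σseq`. -/
def IsLimitWord (σseq : ℕ → Bool → List Bool) (u : ℕ → Bool) : Prop :=
  ∃ useq : ℕ → ℕ → Bool, useq 0 = u ∧ ∀ n, useq n = substApply (σseq n) (useq (n + 1))

/-- Primitivity of a sequence of substitutions in `{L,M,R}^ℕ`: no tail is constantly `L`
and no tail is constantly `R`. -/
def PrimitiveSeq (σseq : ℕ → Bool → List Bool) : Prop :=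
  (¬ ∃ k, ∀ n, k ≤ n → σseq n = Lsub) ∧ ¬ ∃ k, ∀ n, k ≤ n → σseq n = Rsub

/-- `S_{L,M,R}`: the set of limit words of primitive sequences of substitutions. -/
def Sset : Set (ℕ → Bool) :=
  {u | ∃ σseq : ℕ → Bool → List Bool,
    (∀ n, σseq n = Lsub ∨ σseq n = Msub ∨ σseq n = Rsub) ∧
    PrimitiveSeq σseq ∧ IsLimitWord σseq u}

/-- The word `1 0̄ = 1000⋯`. -/
def w10bar : ℕ → Bool := fun n => decide (n = 0)
/-- The word `0 1̄ = 0111⋯`. -/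
def w01bar : ℕ → Bool := fun n => decide (n ≠ 0)
/-- The word `01 0̄ = 01000⋯`. -/
def w010bar : ℕ → Bool := fun n => decide (n = 1)
/-- The word `10 1̄ = 10111⋯`. -/
def w101bar : ℕ → Bool := fun n => decide (n ≠ 1)
/-- The word `0̄`. -/
def w0bar : ℕ → Bool := fun _ => false
/-- The word `1̄`. -/
def w1bar : ℕ → Bool := fun _ => true

/-- Prepend a letter to an infinite word. -/
def consB (b : Bool) (u : ℕ → Bool) : ℕ → Bool := fun n =>
  match n with
  | 0 => b
  | Nat.succ k => u k

/-- Prepend a finite word to an infinite word. -/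
def appendW (w : List Bool) (v : ℕ → Bool) : ℕ → Bool := fun n =>
  if n < w.length then w.getD n false else v (n - w.length)

/-! ### Infinite binary words -/

/-- The suffix of `u` starting at position `k`. -/
def sh (k : ℕ) (u : ℕ → Bool) : ℕ → Bool := fun i => u (i + k)

@[simp] theorem sh_zero (u : ℕ → Bool) : sh 0 u = u := rfl

theorem sh_apply (k : ℕ) (u : ℕ → Bool) (i : ℕ) : sh k u i = u (i + k) := rfl

theorem sh_sh (j k : ℕ) (u : ℕ → Bool) : sh j (sh k u) = sh (j + k) u := by
  funext i; simp only [sh_apply, Nat.add_assoc]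

@[simp] theorem consB_zero (c : Bool) (u : ℕ → Bool) : consB c u 0 = c := rfl

@[simp] theorem consB_succ (c : Bool) (u : ℕ → Bool) (n : ℕ) : consB c u (n + 1) = u n := rfl

@[simp] theorem sh_one_consB (c : Bool) (u : ℕ → Bool) : sh 1 (consB c u) = u := rfl

theorem consB_sh_one (u : ℕ → Bool) : consB (u 0) (sh 1 u) = u := by
  funext n; cases n <;> rfl

theorem sh_eq_consB (k : ℕ) (u : ℕ → Bool) : sh k u = consB (u k) (sh (k + 1) u) := by
  funext n
  cases n with
  | zero => simp [sh_apply]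
  | succ n => simp only [sh_apply, consB_succ]; congr 1; omega

theorem consB_injective (c : Bool) : Function.Injective (consB c) := fun u v h => by
  simpa using congrArg (sh 1) h

/-- Words agreeing on their first `N` letters. -/
def agree (N : ℕ) (u v : ℕ → Bool) : Prop := ∀ i, i < N → u i = v i

theorem agree.trans {N : ℕ} {u v w : ℕ → Bool} (h : agree N u v) (h' : agree N v w) :
    agree N u w := fun i hi => (h i hi).trans (h' i hi)

theorem agree.mono {M N : ℕ} {u v : ℕ → Bool} (h : agree N u v) (hMN : M ≤ N) : agree M u v :=
  fun i hi => h i (hi.trans_le hMN)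

theorem agree.sh {N : ℕ} {u v : ℕ → Bool} (h : agree (N + 1) u v) : agree N (sh 1 u) (sh 1 v) :=
  fun i hi => h (i + 1) (by omega)

theorem agree.consB {N : ℕ} {u v : ℕ → Bool} (h : agree N u v) (c : Bool) :
    agree (N + 1) (consB c u) (consB c v) := fun i hi => by
  cases i with
  | zero => rfl
  | succ i => exact h i (by omega)

theorem eq_of_agree {u v : ℕ → Bool} (h : ∀ N, agree N u v) : u = v :=
  funext fun i => h (i + 1) i (by omega)

/-! ### The lexicographic order -/

theorem lex_false_true (u v : ℕ → Bool) : toLex (consB false u) < toLex (consB true v) :=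
  ⟨0, by simp, by simp⟩

@[simp] theorem lex_consB_lt {c : Bool} {u v : ℕ → Bool} :
    toLex (consB c u) < toLex (consB c v) ↔ toLex u < toLex v := by
  constructor
  · rintro ⟨i, h, hi⟩
    cases i with
    | zero => simp at hi
    | succ i => exact ⟨i, fun j hj => h (j + 1) (by omega), hi⟩
  · rintro ⟨i, h, hi⟩
    refine ⟨i + 1, fun j hj => ?_, hi⟩
    cases j with
    | zero => rfl
    | succ j => exact h j (by omega)

@[simp] theorem lex_consB_le {c : Bool} {u v : ℕ → Bool} :
    toLex (consB c u) ≤ toLex (consB c v) ↔ toLex u ≤ toLex v :=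
  not_lt.symm.trans ((not_congr lex_consB_lt).trans not_lt)

theorem lex_zero_le (u : ℕ → Bool) : toLex w0bar ≤ toLex u := by
  rw [← not_lt]
  rintro ⟨i, -, hi⟩
  exact absurd hi (by simp [w0bar])

theorem lex_le_one (u : ℕ → Bool) : toLex u ≤ toLex w1bar := by
  rw [← not_lt]
  rintro ⟨i, -, hi⟩
  exact absurd hi (by simp [w1bar])

/-- Induction principle for the strict lexicographic order. -/
theorem lex_lt_induction {P : (ℕ → Bool) → (ℕ → Bool) → Prop}
    (head : ∀ u v, P (consB false u) (consB true v))
    (tail : ∀ c u v, P u v → P (consB c u) (consB c v))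
    {u v : ℕ → Bool} (h : toLex u < toLex v) : P u v := by
  obtain ⟨i, h, hi⟩ := h
  change u i < v i at hi
  induction i generalizing u v with
  | zero =>
    have := head (sh 1 u) (sh 1 v)
    have h1 : u 0 = false ∧ v 0 = true := by
      revert hi; cases u 0 <;> cases v 0 <;> simp
    rw [← consB_sh_one u, ← consB_sh_one v, h1.1, h1.2]
    exact this
  | succ i ih =>
    have h0 : u 0 = v 0 := h 0 (by omega)
    have := tail (u 0) (sh 1 u) (sh 1 v) (ih (fun j hj => h (j + 1) (by omega)) hi)
    rw [consB_sh_one, h0, consB_sh_one] at this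
    exact this

theorem lex_consB_false_le (u : ℕ → Bool) : toLex (consB false u) ≤ toLex u := by
  rw [← not_lt]
  intro h
  suffices H : ∀ x y : ℕ → Bool, toLex x < toLex y → y = consB false x → False from H _ _ h rfl
  intro x y hxy
  refine lex_lt_induction (P := fun x y => y = consB false x → False) ?_ ?_ hxy
  · intro u v e; simpa using congrFun e 0
  · intro c u v ih e
    have hc : c = false := congrFun e 0
    subst hc
    exact ih (consB_injective _ e)

theorem lex_le_consB_true (u : ℕ → Bool) : toLex u ≤ toLex (consB true u) := by
  rw [← not_lt]
  intro h
  suffices H : ∀ x y : ℕ → Bool, toLex x < toLex y → x = consB true y → False from H _ _ h rfl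
  intro x y hxy
  refine lex_lt_induction (P := fun x y => x = consB true y → False) ?_ ?_ hxy
  · intro u v e; simpa using congrFun e 0
  · intro c u v ih e
    have hc : c = true := congrFun e 0
    subst hc
    exact ih (consB_injective _ e)

/-- The order is closed: a word approximated by words `≥ b` is itself `≥ b`. -/
theorem le_of_approx_left {b a : ℕ → Bool}
    (h : ∀ N, ∃ s, agree N s a ∧ toLex b ≤ toLex s) : toLex b ≤ toLex a := by
  rw [← not_lt]
  rintro ⟨i, hj, hi⟩
  obtain ⟨s, hs, hbs⟩ := h (i + 1)
  refine absurd hbs (not_le.2 ⟨i, fun j hj' => ?_, ?_⟩)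
  · exact (hs j (by change j < i at hj'; omega)).trans (hj j hj')
  · change s i < b i
    rw [hs i (by omega)]; exact hi

theorem le_of_approx_right {b a : ℕ → Bool}
    (h : ∀ N, ∃ s, agree N s b ∧ toLex s ≤ toLex a) : toLex b ≤ toLex a := by
  rw [← not_lt]
  rintro ⟨i, hj, hi⟩
  obtain ⟨s, hs, hbs⟩ := h (i + 1)
  refine absurd hbs (not_le.2 ⟨i, fun j hj' => ?_, ?_⟩)
  · exact (hj j hj').trans (hs j (by change j < i at hj'; omega)).symm
  · change a i < s i
    rw [hs i (by omega)]; exact hi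

theorem agree_of_between {N : ℕ} {x y z : ℕ → Bool} (hxy : toLex x ≤ toLex y)
    (hyz : toLex y ≤ toLex z) (h : agree N x z) : agree N x y := by
  intro i hi
  induction i using Nat.strong_induction_on with
  | _ i ih =>
    have hlt : ∀ j, j < i → x j = y j := fun j hj => ih j hj (hj.trans hi)
    have h1 : ¬ y i < x i := fun hc =>
      absurd hxy (not_le.2 ⟨i, fun j hj => (hlt j hj).symm, hc⟩)
    have h2 : ¬ z i < y i := fun hc =>
      absurd hyz (not_le.2 ⟨i, fun j (hj : j < i) =>
        (h j (hj.trans hi)).symm.trans (hlt j hj), hc⟩)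
    rw [← h i hi] at h2
    exact le_antisymm (not_lt.1 h1) (not_lt.1 h2)

/-! ### Suprema and infima of orbits -/

theorem lexSupSeq_eq_true_iff {S : Set (ℕ → Bool)} {n : ℕ} :
    lexSupSeq S n = true ↔ ∃ u ∈ S, (∀ i, i < n → u i = lexSupSeq S i) ∧ u n = true := by
  classical
  rw [lexSupSeq]
  convert decide_eq_true_iff

theorem lexInfSeq_eq_false_iff {S : Set (ℕ → Bool)} {n : ℕ} :
    lexInfSeq S n = false ↔ ∃ u ∈ S, (∀ i, i < n → u i = lexInfSeq S i) ∧ u n = false := by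
  classical
  rw [lexInfSeq]
  convert decide_eq_false_iff_not.trans not_not

theorem lexSupSeq_eq {S : Set (ℕ → Bool)} {a : ℕ → Bool} (hle : ∀ s ∈ S, toLex s ≤ toLex a)
    (hap : ∀ N, ∃ s ∈ S, agree N s a) : lexSupSeq S = a := by
  funext n
  induction n using Nat.strong_induction_on with
  | _ n ih =>
    rw [Bool.eq_iff_iff, lexSupSeq_eq_true_iff]
    constructor
    · rintro ⟨s, hs, hsa, hn⟩
      by_contra h
      have h' : a n = false := by simpa using h
      refine absurd (hle s hs) (not_le.2 ⟨n, fun j hj => ?_, ?_⟩)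
      · exact ((hsa j hj).trans (ih j hj)).symm
      · change a n < s n
        rw [h', hn]; decide
    · intro h
      obtain ⟨s, hs, hsa⟩ := hap (n + 1)
      exact ⟨s, hs, fun i hi => (hsa i (by omega)).trans (ih i hi).symm,
        (hsa n (by omega)).trans h⟩

theorem lexInfSeq_eq {S : Set (ℕ → Bool)} {a : ℕ → Bool} (hle : ∀ s ∈ S, toLex a ≤ toLex s)
    (hap : ∀ N, ∃ s ∈ S, agree N s a) : lexInfSeq S = a := by
  funext n
  induction n using Nat.strong_induction_on with
  | _ n ih =>
    rw [← Bool.not_inj_iff, Bool.eq_iff_iff, Bool.not_eq_true', Bool.not_eq_true',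
      lexInfSeq_eq_false_iff]
    constructor
    · rintro ⟨s, hs, hsa, hn⟩
      by_contra h
      have h' : a n = true := by simpa using h
      refine absurd (hle s hs) (not_le.2 ⟨n, fun j hj => ?_, ?_⟩)
      · exact (hsa j hj).trans (ih j hj)
      · change s n < a n
        rw [h', hn]; decide
    · intro h
      obtain ⟨s, hs, hsa⟩ := hap (n + 1)
      exact ⟨s, hs, fun i hi => (hsa i (by omega)).trans (ih i hi).symm,
        (hsa n (by omega)).trans h⟩

theorem supO_eq {u a : ℕ → Bool} (hle : ∀ k, toLex (sh k u) ≤ toLex a)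
    (hap : ∀ N, ∃ k, agree N (sh k u) a) : supO u = a := by
  refine lexSupSeq_eq ?_ ?_
  · rintro s ⟨k, rfl⟩; exact hle k
  · intro N; obtain ⟨k, hk⟩ := hap N; exact ⟨_, ⟨k, rfl⟩, hk⟩

theorem infO_eq {u b : ℕ → Bool} (hle : ∀ k, toLex b ≤ toLex (sh k u))
    (hap : ∀ N, ∃ k, agree N (sh k u) b) : infO u = b := by
  refine lexInfSeq_eq ?_ ?_
  · rintro s ⟨k, rfl⟩; exact hle k
  · intro N; obtain ⟨k, hk⟩ := hap N; exact ⟨_, ⟨k, rfl⟩, hk⟩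

/-- For a nonempty set the greedy supremum is approximated by elements of the set. -/
theorem lexSupSeq_approx {S : Set (ℕ → Bool)} (hS : S.Nonempty) (N : ℕ) :
    ∃ s ∈ S, agree N s (lexSupSeq S) := by
  induction N with
  | zero => exact hS.imp fun s hs => ⟨hs, fun i hi => absurd hi (by omega)⟩
  | succ N ih =>
    by_cases h : lexSupSeq S N = true
    · have h' := h
      rw [lexSupSeq_eq_true_iff] at h'
      obtain ⟨s, hs, hsa, hn⟩ := h'
      refine ⟨s, hs, fun i hi => ?_⟩
      rcases Nat.lt_succ_iff_lt_or_eq.1 hi with hi | rfl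
      · exact hsa i hi
      · rw [hn, h]
    · obtain ⟨s, hs, hsa⟩ := ih
      refine ⟨s, hs, fun i hi => ?_⟩
      rcases Nat.lt_succ_iff_lt_or_eq.1 hi with hi | rfl
      · exact hsa i hi
      · by_contra hne
        have hsi : s i = true := by
          revert hne h; cases s i <;> cases lexSupSeq S i <;> simp
        apply h
        rw [lexSupSeq_eq_true_iff]
        exact ⟨s, hs, hsa, hsi⟩

theorem le_lexSupSeq {S : Set (ℕ → Bool)} {s : ℕ → Bool} (hs : s ∈ S) :
    toLex s ≤ toLex (lexSupSeq S) := by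
  rw [← not_lt]
  rintro ⟨i, hj, hi⟩
  change lexSupSeq S i < s i at hi
  have h1 : s i = true := by revert hi; cases s i <;> simp
  have h2 : lexSupSeq S i = true := by
    rw [lexSupSeq_eq_true_iff]
    exact ⟨s, hs, fun j hj' => (hj j hj').symm, h1⟩
  rw [h1, h2] at hi
  exact lt_irrefl _ hi

theorem lexInfSeq_approx {S : Set (ℕ → Bool)} (hS : S.Nonempty) (N : ℕ) :
    ∃ s ∈ S, agree N s (lexInfSeq S) := by
  induction N with
  | zero => exact hS.imp fun s hs => ⟨hs, fun i hi => absurd hi (by omega)⟩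
  | succ N ih =>
    by_cases h : lexInfSeq S N = false
    · have h' := h
      rw [lexInfSeq_eq_false_iff] at h'
      obtain ⟨s, hs, hsa, hn⟩ := h'
      refine ⟨s, hs, fun i hi => ?_⟩
      rcases Nat.lt_succ_iff_lt_or_eq.1 hi with hi | rfl
      · exact hsa i hi
      · rw [hn, h]
    · obtain ⟨s, hs, hsa⟩ := ih
      refine ⟨s, hs, fun i hi => ?_⟩
      rcases Nat.lt_succ_iff_lt_or_eq.1 hi with hi | rfl
      · exact hsa i hi
      · by_contra hne
        have hsi : s i = false := by
          revert hne h; cases s i <;> cases lexInfSeq S i <;> simp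
        apply h
        rw [lexInfSeq_eq_false_iff]
        exact ⟨s, hs, hsa, hsi⟩

theorem lexInfSeq_le {S : Set (ℕ → Bool)} {s : ℕ → Bool} (hs : s ∈ S) :
    toLex (lexInfSeq S) ≤ toLex s := by
  rw [← not_lt]
  rintro ⟨i, hj, hi⟩
  change s i < lexInfSeq S i at hi
  have h1 : s i = false := by revert hi; cases s i <;> simp
  have h2 : lexInfSeq S i = false := by
    rw [lexInfSeq_eq_false_iff]
    exact ⟨s, hs, hj, h1⟩
  rw [h1, h2] at hi
  exact lt_irrefl _ hi

theorem sh_le_supO (u : ℕ → Bool) (k : ℕ) : toLex (sh k u) ≤ toLex (supO u) :=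
  le_lexSupSeq ⟨k, rfl⟩

theorem infO_le_sh (u : ℕ → Bool) (k : ℕ) : toLex (infO u) ≤ toLex (sh k u) :=
  lexInfSeq_le ⟨k, rfl⟩

/-! ### The generating function of a word -/

/-- `B q u = ∑ uₖ qᵏ`. -/
noncomputable def B (q : ℝ) (u : ℕ → Bool) : ℝ := ∑' k : ℕ, (if u k then (1 : ℝ) else 0) * q ^ k

section
variable {q : ℝ}

theorem B_summable (h0 : 0 ≤ q) (h1 : q < 1) (u : ℕ → Bool) :
    Summable fun k : ℕ => (if u k then (1 : ℝ) else 0) * q ^ k := by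
  refine Summable.of_nonneg_of_le (fun k => by split_ifs <;> positivity) (fun k => ?_)
    (summable_geometric_of_lt_one h0 h1)
  split_ifs
  · simp
  · simpa using pow_nonneg h0 k

theorem B_nonneg (h0 : 0 ≤ q) (u : ℕ → Bool) : 0 ≤ B q u :=
  tsum_nonneg fun k => by split_ifs <;> positivity

theorem B_rec (h0 : 0 ≤ q) (h1 : q < 1) (u : ℕ → Bool) :
    B q u = (if u 0 then 1 else 0) + q * B q (sh 1 u) := by
  rw [B, (B_summable h0 h1 u).tsum_eq_zero_add, B, ← tsum_mul_left]
  congr 1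
  · simp
  · refine tsum_congr fun k => ?_
    rw [sh_apply, pow_succ]; ring

theorem B_true (h0 : 0 ≤ q) (h1 : q < 1) (u : ℕ → Bool) :
    B q (consB true u) = 1 + q * B q u := by
  rw [B_rec h0 h1]; simp

theorem B_false (h0 : 0 ≤ q) (h1 : q < 1) (u : ℕ → Bool) :
    B q (consB false u) = q * B q u := by
  rw [B_rec h0 h1]; simp

theorem B_consB_sub (h0 : 0 ≤ q) (h1 : q < 1) (c : Bool) (u v : ℕ → Bool) :
    B q (consB c u) - B q (consB c v) = q * (B q u - B q v) := by
  cases c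
  · rw [B_false h0 h1, B_false h0 h1]; ring
  · rw [B_true h0 h1, B_true h0 h1]; ring

theorem B_le (h0 : 0 ≤ q) (h1 : q < 1) (u : ℕ → Bool) : B q u ≤ (1 - q)⁻¹ := by
  rw [← tsum_geometric_of_lt_one h0 h1]
  refine (B_summable h0 h1 u).tsum_le_tsum (fun k => ?_) (summable_geometric_of_lt_one h0 h1)
  split_ifs
  · simp
  · simpa using pow_nonneg h0 k

/-- The complementary word. -/
def flipW (u : ℕ → Bool) : ℕ → Bool := fun k => !u k

theorem B_add_flipW (h0 : 0 ≤ q) (h1 : q < 1) (u : ℕ → Bool) :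
    B q u + B q (flipW u) = (1 - q)⁻¹ := by
  rw [← tsum_geometric_of_lt_one h0 h1, B, B,
    ← (B_summable h0 h1 u).tsum_add (B_summable h0 h1 (flipW u))]
  refine tsum_congr fun k => ?_
  cases h : u k <;> simp [flipW, h]

theorem B_agree (h0 : 0 ≤ q) (h1 : q < 1) {N : ℕ} {u v : ℕ → Bool} (h : agree N u v) :
    |B q u - B q v| ≤ q ^ N * (1 - q)⁻¹ := by
  induction N generalizing u v with
  | zero =>
    have := B_le h0 h1 u
    have := B_le h0 h1 v
    have := B_nonneg h0 u
    have := B_nonneg h0 v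
    rw [abs_le]; constructor <;> simp <;> linarith
  | succ N ih =>
    rw [← consB_sh_one u, ← consB_sh_one v, h 0 (by omega), B_consB_sub h0 h1, abs_mul,
      abs_of_nonneg h0, pow_succ]
    have := mul_le_mul_of_nonneg_left (ih h.sh) h0
    linarith

theorem B_mono_of_le {r : ℝ} (h0 : 0 ≤ q) (hqr : q ≤ r) (h1 : r < 1) (u : ℕ → Bool) :
    B q u ≤ B r u := by
  refine (B_summable h0 (hqr.trans_lt h1) u).tsum_le_tsum (fun k => ?_)
    (B_summable (h0.trans hqr) h1 u)
  split_ifs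
  · simpa using pow_le_pow_left₀ h0 hqr k
  · simp

theorem B_strictMono {r : ℝ} (h0 : 0 ≤ q) (hqr : q < r) (h1 : r < 1) {u : ℕ → Bool}
    {k : ℕ} (hk : k ≠ 0) (hu : u k = true) : B q u < B r u := by
  refine Summable.tsum_lt_tsum (i := k) (fun k => ?_) ?_ (B_summable h0 (hqr.trans h1) u)
    (B_summable (h0.trans hqr.le) h1 u)
  · beta_reduce
    split_ifs
    · simpa using pow_le_pow_left₀ h0 hqr.le k
    · simp
  · simpa [hu] using pow_lt_pow_left₀ hqr h0 hk

theorem B_continuousOn {r : ℝ} (h0 : 0 ≤ r) (h1 : r < 1) (u : ℕ → Bool) :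
    ContinuousOn (fun q => B q u) (Set.Icc 0 r) := by
  refine continuousOn_tsum (u := fun k => r ^ k) (fun k => by fun_prop)
    (summable_geometric_of_lt_one h0 h1) (fun k q hq => ?_)
  rw [Real.norm_eq_abs, abs_of_nonneg (by split_ifs <;> simp [pow_nonneg hq.1])]
  split_ifs
  · simpa using pow_le_pow_left₀ hq.1 hq.2 k
  · simpa using pow_nonneg h0 k

theorem B_lex_le (h0 : 0 < q) (h1 : q ≤ 1 / 2) {u v : ℕ → Bool} (h : toLex u ≤ toLex v) :
    B q u ≤ B q v := by
  have h1' : q < 1 := by linarith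
  rcases h.eq_or_lt with h | h
  · rw [toLex.injective h]
  refine lex_lt_induction (P := fun u v => B q u ≤ B q v) ?_ ?_ h
  · intro u v
    rw [B_false h0.le h1', B_true h0.le h1']
    have h2 := mul_le_mul_of_nonneg_left (B_le h0.le h1' u) h0.le
    have h3 := mul_nonneg h0.le (B_nonneg h0.le v)
    have h4 : q * (1 - q)⁻¹ ≤ 1 := by
      rw [← div_eq_mul_inv, div_le_one (by linarith)]; linarith
    linarith
  · intro c u v huv
    have := B_consB_sub h0.le h1' c u v
    nlinarith

end

theorem piB_eq (β : ℝ) (u : ℕ → Bool) : piB β u = β⁻¹ * B β⁻¹ u := by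
  rw [piB, B, ← tsum_mul_left]
  refine tsum_congr fun k => ?_
  rw [div_eq_mul_inv, pow_succ, mul_inv, inv_pow]; ring

/-! ### The two functions of the base attached to a pair of words -/

/-- `F β a = β π_β(a)`. -/
noncomputable def F (β : ℝ) (a : ℕ → Bool) : ℝ := β * piB β a

/-- `G β b = (β - 1)(1 + π_β(b))`. -/
noncomputable def G (β : ℝ) (b : ℕ → Bool) : ℝ := (β - 1) * (1 + piB β b)

section
variable {β : ℝ}

theorem inv_bounds (hβ : 1 < β) : 0 < β⁻¹ ∧ β⁻¹ < 1 :=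
  ⟨inv_pos.2 (by linarith), inv_lt_one_of_one_lt₀ hβ⟩

theorem F_eq (hβ : 1 < β) (a : ℕ → Bool) : F β a = B β⁻¹ a := by
  rw [F, piB_eq, ← mul_assoc, mul_inv_cancel₀ (by linarith), one_mul]

theorem F_true (hβ : 1 < β) (a : ℕ → Bool) : F β (consB true a) = 1 + piB β a := by
  obtain ⟨h0, h1⟩ := inv_bounds hβ
  rw [F_eq hβ, B_true h0.le h1, piB_eq]

theorem G_eq_flipW (hβ : 1 < β) (b : ℕ → Bool) :
    G β b = β - (1 - β⁻¹) * B β⁻¹ (flipW b) := by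
  obtain ⟨h0, h1⟩ := inv_bounds hβ
  have h := B_add_flipW h0.le h1 b
  have h2 : B β⁻¹ b = (1 - β⁻¹)⁻¹ - B β⁻¹ (flipW b) := by linarith
  rw [G, piB_eq, h2]
  have : β - 1 ≠ 0 := by linarith
  have : β ≠ 0 := by linarith
  have h3 : (1 - β⁻¹)⁻¹ = β / (β - 1) := by
    rw [show 1 - β⁻¹ = (β - 1) / β by field_simp, inv_div]
  rw [h3]
  field_simp
  ring

theorem G_ge (hβ : 1 < β) (b : ℕ → Bool) : β - 1 ≤ G β b := by
  obtain ⟨h0, h1⟩ := inv_bounds hβ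
  rw [G, piB_eq]
  have := mul_nonneg h0.le (B_nonneg h0.le b)
  nlinarith

theorem G_le (hβ : 1 < β) (b : ℕ → Bool) : G β b ≤ β := by
  obtain ⟨h0, h1⟩ := inv_bounds hβ
  rw [G_eq_flipW hβ]
  have := mul_nonneg (by linarith : 0 ≤ 1 - β⁻¹) (B_nonneg h0.le (flipW b))
  linarith

/-- `G` increases strictly to the right of any base at which it is at least `1`. -/
theorem G_strictMono {γ : ℝ} (hβ : 1 < β) (hγ : β < γ) {b : ℕ → Bool} (h : 1 ≤ G β b) :
    G β b < G γ b := by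
  obtain ⟨h0, h1⟩ := inv_bounds hβ
  obtain ⟨h0', h1'⟩ := inv_bounds (hβ.trans hγ)
  have hlt : γ⁻¹ < β⁻¹ := inv_strictAnti₀ (by linarith) hγ
  rw [G_eq_flipW hβ] at h ⊢
  rw [G_eq_flipW (hβ.trans hγ)]
  have hC := B_mono_of_le h0'.le hlt.le h1 (flipW b)
  set C := B β⁻¹ (flipW b)
  set D := B γ⁻¹ (flipW b)
  have hCle : C ≤ β := by
    have h2 : (1 - β⁻¹) * C ≤ (1 - β⁻¹) * β := by
      have : (1 - β⁻¹) * β = β - 1 := by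
        rw [sub_mul, inv_mul_cancel₀ (by linarith)]; ring
      linarith
    exact le_of_mul_le_mul_left h2 (by linarith)
  have hd : (β⁻¹ - γ⁻¹) * C ≤ (β⁻¹ - γ⁻¹) * β := mul_le_mul_of_nonneg_left hCle (by linarith)
  have he : (1 - γ⁻¹) * D ≤ (1 - γ⁻¹) * C := mul_le_mul_of_nonneg_left hC (by linarith)
  have hf : (β⁻¹ - γ⁻¹) * β < γ - β := by
    have e : (β⁻¹ - γ⁻¹) * β = (γ - β) * γ⁻¹ := by
      have : γ ≠ 0 := by linarith
      have : β ≠ 0 := by linarith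
      field_simp
    rw [e]; nlinarith
  linarith

theorem F_strictAnti {γ : ℝ} (hβ : 1 < β) (hγ : β < γ) {a : ℕ → Bool} {k : ℕ} (hk : k ≠ 0)
    (ha : a k = true) : F γ a < F β a := by
  rw [F_eq hβ, F_eq (hβ.trans hγ)]
  exact B_strictMono (inv_bounds (hβ.trans hγ)).1.le (inv_strictAnti₀ (by linarith) hγ)
    (inv_bounds hβ).2 hk ha

theorem F_continuousOn (hβ : 1 < β) (γ : ℝ) (a : ℕ → Bool) :
    ContinuousOn (fun x => F x a) (Set.Icc β γ) := by
  have h := B_continuousOn (inv_bounds hβ).1.le (inv_bounds hβ).2 a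
  have hc : ContinuousOn (fun x => B x⁻¹ a) (Set.Icc β γ) :=
    h.comp (f := fun x : ℝ => x⁻¹)
      (continuousOn_inv₀.mono fun x hx => by
        have := hx.1; simp; linarith)
      (fun x hx => ⟨(inv_bounds (hβ.trans_le hx.1)).1.le, inv_anti₀ (by linarith) hx.1⟩)
  exact hc.congr fun x hx => F_eq (hβ.trans_le hx.1) a

theorem G_continuousOn (hβ : 1 < β) (γ : ℝ) (b : ℕ → Bool) :
    ContinuousOn (fun x => G x b) (Set.Icc β γ) := by
  have h := F_continuousOn hβ γ b
  have e : Set.EqOn (fun x => G x b) (fun x => (x - 1) * (1 + F x b / x)) (Set.Icc β γ) := by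
    intro x hx
    have : x ≠ 0 := by have := hx.1; linarith
    simp only [G, F]
    field_simp
  refine ContinuousOn.congr ?_ e
  have : ∀ x ∈ Set.Icc β γ, x ≠ 0 := fun x hx => by have := hx.1; linarith
  fun_prop (disch := assumption)

theorem F_near (hβ : 1 < β) {ε : ℝ} (hε : 0 < ε) :
    ∃ N, ∀ u v, agree N u v → |F β u - F β v| < ε := by
  obtain ⟨h0, h1⟩ := inv_bounds hβ
  obtain ⟨N, hN⟩ := exists_pow_lt_of_lt_one (mul_pos hε (sub_pos.2 h1)) h1
  refine ⟨N, fun u v h => ?_⟩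
  rw [F_eq hβ, F_eq hβ]
  refine (B_agree h0.le h1 h).trans_lt ?_
  rw [← div_eq_mul_inv, div_lt_iff₀ (by linarith)]
  exact hN

theorem G_near (hβ : 1 < β) {ε : ℝ} (hε : 0 < ε) :
    ∃ N, ∀ u v, agree N u v → |G β u - G β v| < ε := by
  obtain ⟨N, hN⟩ := F_near hβ (div_pos hε (sub_pos.2 hβ))
  refine ⟨N, fun u v h => ?_⟩
  have h1 := hN u v h
  have e : G β u - G β v = (β - 1) * β⁻¹ * (F β u - F β v) := by
    have : β ≠ 0 := by linarith
    simp only [G, F]; field_simp; ring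
  rw [lt_div_iff₀ (by linarith)] at h1
  have h2 := (inv_bounds hβ).2
  have h3 := (inv_bounds hβ).1
  rw [e, abs_mul, abs_of_nonneg (mul_nonneg (by linarith) h3.le)]
  have h4 := abs_nonneg (F β u - F β v)
  have h5 : β⁻¹ * ((β - 1) * |F β u - F β v|) ≤ 1 * ((β - 1) * |F β u - F β v|) :=
    mul_le_mul_of_nonneg_right h2.le (mul_nonneg (by linarith) h4)
  calc _ = β⁻¹ * ((β - 1) * |F β u - F β v|) := by ring
    _ ≤ _ := h5
    _ < ε := by linarith

theorem F_lex_le (hβ : 2 ≤ β) {u v : ℕ → Bool} (h : toLex u ≤ toLex v) : F β u ≤ F β v := by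
  rw [F_eq (by linarith), F_eq (by linarith)]
  refine B_lex_le (inv_pos.2 (by linarith)) ?_ h
  rw [one_div]; exact inv_anti₀ (by norm_num) hβ

theorem G_eq_F (hβ : 1 < β) (b : ℕ → Bool) : G β b = (β - 1) * F β (consB true b) := by
  rw [F_true hβ, G]

theorem G_lex_le (hβ : 2 ≤ β) {u v : ℕ → Bool} (h : toLex u ≤ toLex v) : G β u ≤ G β v := by
  rw [G_eq_F (by linarith), G_eq_F (by linarith)]
  exact mul_le_mul_of_nonneg_left (F_lex_le hβ (lex_consB_le.2 h)) (by linarith)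

end

/-! ### The values `f`, `g` and `μ` -/

/-- `fVal` as a function of the supremum of the orbit. -/
noncomputable def fv (a : ℕ → Bool) (m : ℝ) : ℝ := sInf {β : ℝ | 1 ≤ β ∧ F β a = m}

/-- `gVal` as a function of the infimum of the orbit. -/
noncomputable def gv (b : ℕ → Bool) (m : ℝ) : ℝ := sInf {β : ℝ | 1 < β ∧ G β b = m}

/-- `muVal` as a function of the infimum and supremum of the orbit. -/
noncomputable def muv (b a : ℕ → Bool) : ℝ := sInf {m : ℝ | 1 < m ∧ m ≤ 2 ∧ fv a m = gv b m}

theorem fVal_eq (u : ℕ → Bool) (m : ℝ) : fVal u m = fv (supO u) m := rfl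

theorem gVal_eq (u : ℕ → Bool) (m : ℝ) : gVal u m = gv (infO u) m := rfl

theorem muVal_eq (u : ℕ → Bool) : muVal u = muv (infO u) (supO u) := rfl

/-- The word contains infinitely many ones. -/
def InfOnes (a : ℕ → Bool) : Prop := ∀ N, ∃ k, N ≤ k ∧ a k = true

theorem F_one {a : ℕ → Bool} (ha : InfOnes a) : F 1 a = 0 := by
  rw [F, one_mul, piB]
  refine tsum_eq_zero_of_not_summable fun h => ?_
  have h0 := h.tendsto_atTop_zero
  rw [Metric.tendsto_atTop] at h0
  obtain ⟨N, hN⟩ := h0 1 one_pos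
  obtain ⟨k, hk, hak⟩ := ha N
  simpa [hak] using hN k hk

theorem exists_F_ge_two {a : ℕ → Bool} (ha : InfOnes a) : ∃ β, 1 < β ∧ β < 2 ∧ 2 ≤ F β a := by
  obtain ⟨k, -, hk⟩ := ha 0
  obtain ⟨l, hkl, hl⟩ := ha (k + 1)
  obtain ⟨p, hlp, hp⟩ := ha (l + 1)
  have hc : ContinuousAt (fun β : ℝ => β⁻¹ ^ k + β⁻¹ ^ l + β⁻¹ ^ p) 1 := by
    have : (1 : ℝ) ≠ 0 := one_ne_zero
    fun_prop (disch := assumption)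
  have h2 : ∀ᶠ β : ℝ in nhds 1, 2 < β⁻¹ ^ k + β⁻¹ ^ l + β⁻¹ ^ p :=
    hc.eventually_const_lt (by norm_num)
  have h3 : ∀ᶠ β : ℝ in nhdsWithin 1 (Set.Ioi 1), 1 < β ∧ β < 2 :=
    Ioo_mem_nhdsGT (by norm_num)
  obtain ⟨β, hβ, h1, hlt⟩ := ((h2.filter_mono nhdsWithin_le_nhds).and h3).exists
  refine ⟨β, h1, hlt, ?_⟩
  obtain ⟨q0, q1⟩ := inv_bounds h1
  rw [F_eq h1]
  refine hβ.le.trans ?_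
  have := (B_summable q0.le q1 a).sum_le_tsum {k, l, p}
    (fun i _ => by split_ifs <;> positivity)
  rw [Finset.sum_insert (by simp; omega), Finset.sum_pair (by omega)] at this
  simp only [hk, hl, hp, if_true, one_mul, ← add_assoc] at this
  exact this

theorem F_le {β : ℝ} (hβ : 1 < β) (a : ℕ → Bool) : F β a ≤ β / (β - 1) := by
  obtain ⟨q0, q1⟩ := inv_bounds hβ
  have h := B_le q0.le q1 a
  have : β - 1 ≠ 0 := by linarith
  have : β ≠ 0 := by linarith
  have h3 : (1 - β⁻¹)⁻¹ = β / (β - 1) := by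
    rw [show 1 - β⁻¹ = (β - 1) / β by field_simp, inv_div]
  rwa [F_eq hβ, ← h3]

theorem InfOnes.F_strictAnti {a : ℕ → Bool} (ha : InfOnes a) {β γ : ℝ} (hβ : 1 < β)
    (hγ : β < γ) : F γ a < F β a := by
  obtain ⟨k, hk, hak⟩ := ha 1
  exact _root_.F_strictAnti hβ hγ (k := k) (by omega) hak

theorem fv_spec {a : ℕ → Bool} (ha : InfOnes a) {m : ℝ} (h1 : 1 < m) (h2 : m ≤ 2) :
    1 < fv a m ∧ F (fv a m) a = m := by
  obtain ⟨γ, hγ1, hγ2, hγ⟩ := exists_F_ge_two ha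
  have hm : 2 ≤ m / (m - 1) := by rw [le_div_iff₀ (by linarith)]; linarith
  have hF : F (m / (m - 1)) a ≤ m := by
    refine (F_le (by linarith) a).trans_eq ?_
    have : m - 1 ≠ 0 := by linarith
    field_simp
    ring
  obtain ⟨β, hβ, hβm⟩ := intermediate_value_Icc' (by linarith : γ ≤ m / (m - 1))
    (F_continuousOn hγ1 _ a) ⟨hF, h2.trans hγ⟩
  have hβ1 : 1 < β := hγ1.trans_le hβ.1
  have : {β : ℝ | 1 ≤ β ∧ F β a = m} = {β} := by
    ext x
    simp only [Set.mem_ofPred_eq, Set.mem_singleton_iff]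
    refine ⟨fun ⟨hx, hxm⟩ => ?_, fun hx => hx ▸ ⟨hβ1.le, hβm⟩⟩
    rcases hx.eq_or_lt with rfl | hx
    · rw [F_one ha] at hxm; linarith
    · rcases lt_trichotomy x β with h | h | h
      · have := ha.F_strictAnti hx h; simp only at hβm; linarith
      · exact h
      · have := ha.F_strictAnti hβ1 h; simp only at hβm; linarith
  rw [fv, this, csInf_singleton]
  exact ⟨hβ1, hβm⟩

theorem gv_spec (b : ℕ → Bool) {m : ℝ} (h1 : 1 < m) :
    1 < gv b m ∧ G (gv b m) b = m ∧ gv b m ≤ 1 + m := by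
  have hG : m ≤ G (1 + m) b := by
    have := G_ge (by linarith : 1 < 1 + m) b
    linarith
  obtain ⟨β, hβ, hβm⟩ := intermediate_value_Icc (by linarith : m ≤ 1 + m)
    (G_continuousOn h1 _ b) ⟨G_le h1 b, hG⟩
  simp only at hβm
  have hβ1 : 1 < β := h1.trans_le hβ.1
  have : {β : ℝ | 1 < β ∧ G β b = m} = {β} := by
    ext x
    simp only [Set.mem_ofPred_eq, Set.mem_singleton_iff]
    refine ⟨fun ⟨hx, hxm⟩ => ?_, fun hx => hx ▸ ⟨hβ1, hβm⟩⟩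
    rcases lt_trichotomy x β with h | h | h
    · have := G_strictMono hx h (by linarith); linarith
    · exact h
    · have := G_strictMono hβ1 h (by linarith); linarith
  rw [gv, this, csInf_singleton]
  exact ⟨hβ1, hβm, hβ.2⟩

theorem lt_fv {a : ℕ → Bool} (ha : InfOnes a) {m β : ℝ} (h1 : 1 < m) (h2 : m ≤ 2)
    (hβ : 1 < β) (h : β < fv a m) : m < F β a := by
  obtain ⟨-, hm⟩ := fv_spec ha h1 h2
  have := ha.F_strictAnti hβ h
  linarith

theorem fv_lt {a : ℕ → Bool} (ha : InfOnes a) {m β : ℝ} (h1 : 1 < m) (h2 : m ≤ 2)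
    (h : fv a m < β) : F β a < m := by
  obtain ⟨hf, hm⟩ := fv_spec ha h1 h2
  have := ha.F_strictAnti hf h
  linarith

theorem gv_lt {b : ℕ → Bool} {m β : ℝ} (h1 : 1 < m) (h : gv b m < β) : m < G β b := by
  obtain ⟨hf, hm, -⟩ := gv_spec b h1
  have := G_strictMono hf h (by linarith)
  linarith

theorem lt_gv {b : ℕ → Bool} {m β : ℝ} (h1 : 1 < m) (hβ : 1 < β) (h : β < gv b m) :
    G β b < m := by
  obtain ⟨hf, hm, -⟩ := gv_spec b h1
  by_contra hc
  have := G_strictMono hβ h (b := b) (by linarith)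
  linarith

theorem fv_anti {a : ℕ → Bool} (ha : InfOnes a) {m n : ℝ} (h1 : 1 < m) (hn : m < n)
    (h2 : n ≤ 2) : fv a n < fv a m := by
  obtain ⟨hf, hm⟩ := fv_spec ha h1 (hn.le.trans h2)
  obtain ⟨hf', hm'⟩ := fv_spec ha (h1.trans hn) h2
  by_contra hc
  rcases (not_lt.1 hc).eq_or_lt with h | h
  · rw [h] at hm; linarith
  · have := ha.F_strictAnti hf h; linarith

theorem gv_mono (b : ℕ → Bool) {m n : ℝ} (h1 : 1 < m) (hn : m < n) : gv b m < gv b n := by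
  obtain ⟨hf, hm, -⟩ := gv_spec b h1
  obtain ⟨hf', hm', -⟩ := gv_spec b (h1.trans hn)
  by_contra hc
  rcases (not_lt.1 hc).eq_or_lt with h | h
  · rw [h] at hm'; linarith
  · have := G_strictMono hf' h (b := b) (by linarith); linarith

/-- Pairs `(b, a)` that behave like `(inf O(u), sup O(u))` for a nondegenerate word `u`. -/
structure Good (b a : ℕ → Bool) : Prop where
  le : toLex (consB true b) ≤ toLex a
  ones : InfOnes a

namespace Good

variable {b a : ℕ → Bool}

theorem head (h : Good b a) : a 0 = true := by
  by_contra h0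
  have h0' : a 0 = false := by simpa using h0
  have := lex_false_true (sh 1 a) b
  rw [← h0', consB_sh_one] at this
  exact absurd h.le (not_le.2 this)

theorem one_lt_F (h : Good b a) {β : ℝ} (hβ : 1 < β) : 1 < F β a := by
  obtain ⟨k, hk, hak⟩ := h.ones 1
  have h1 := _root_.F_strictAnti hβ (lt_add_one β) (k := k) (by omega) hak
  have h2 : 1 ≤ F (β + 1) a := by
    rw [← consB_sh_one a, h.head, F_true (by linarith), piB_eq]
    have h0 := (inv_bounds (by linarith : 1 < β + 1)).1.le
    have := mul_nonneg h0 (B_nonneg h0 (sh 1 a))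
    linarith
  linarith

theorem G_two_le (h : Good b a) : G 2 b ≤ F 2 a := by
  rw [G_eq_F (by norm_num)]
  have := F_lex_le le_rfl h.le
  linarith

theorem two_lt (h : Good b a) {m β : ℝ} (h1 : 1 < m) (h2 : m ≤ 2) (hf : fv a m < β)
    (hg : gv b m < β) : 2 < β := by
  by_contra hc
  have h3 := fv_lt h.ones h1 h2 (hf.trans_le (not_lt.1 hc))
  have h4 := gv_lt h1 (hg.trans_le (not_lt.1 hc))
  linarith [h.G_two_le]

theorem exists_cross (h : Good b a) :
    ∃ m, 1 < m ∧ m ≤ 2 ∧ fv a m = gv b m := by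
  have hc : ContinuousOn (fun x => G x b - F x a) (Set.Icc 2 4) :=
    (G_continuousOn (by norm_num) 4 b).sub (F_continuousOn (by norm_num) 4 a)
  have h4 := G_ge (by norm_num : (1 : ℝ) < 4) b
  have h4' := F_le (by norm_num : (1 : ℝ) < 4) a
  norm_num at h4 h4'
  obtain ⟨β, hβ, he⟩ := intermediate_value_Icc (by norm_num : (2 : ℝ) ≤ 4) hc
    (show (0 : ℝ) ∈ Set.Icc _ _ from ⟨by linarith [h.G_two_le], by linarith⟩)
  simp only at he
  have hβ1 : 1 < β := by linarith [hβ.1]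
  have h1 := h.one_lt_F hβ1
  have h2 : F β a ≤ 2 := by
    refine (F_le hβ1 a).trans ?_
    rw [div_le_iff₀ (by linarith)]; linarith [hβ.1]
  refine ⟨F β a, h1, h2, ?_⟩
  have e1 : fv a (F β a) = β := by
    refine le_antisymm (not_lt.1 fun hlt => ?_) (not_lt.1 fun hlt => ?_)
    · exact lt_irrefl _ (lt_fv h.ones h1 h2 hβ1 hlt)
    · exact lt_irrefl _ (fv_lt h.ones h1 h2 hlt)
  have e2 : gv b (F β a) = β := by
    refine le_antisymm (not_lt.1 fun hlt => ?_) (not_lt.1 fun hlt => ?_)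
    · have := lt_gv h1 hβ1 hlt; linarith
    · have := gv_lt h1 hlt; linarith
  rw [e1, e2]

theorem muv_spec (h : Good b a) : 1 < muv b a ∧ muv b a ≤ 2 ∧ fv a (muv b a) = gv b (muv b a) := by
  obtain ⟨m, h1, h2, he⟩ := h.exists_cross
  have : {m : ℝ | 1 < m ∧ m ≤ 2 ∧ fv a m = gv b m} = {m} := by
    ext x
    simp only [Set.mem_ofPred_eq, Set.mem_singleton_iff]
    refine ⟨fun ⟨hx1, hx2, hx⟩ => ?_, fun hx => hx ▸ ⟨h1, h2, he⟩⟩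
    rcases lt_trichotomy x m with hlt | hlt | hlt
    · have := fv_anti h.ones hx1 hlt h2
      have := gv_mono b hx1 hlt
      linarith
    · exact hlt
    · have := fv_anti h.ones h1 hlt hx2
      have := gv_mono b h1 hlt
      linarith
  rw [muv, this, csInf_singleton]
  exact ⟨h1, h2, he⟩

theorem fv_le_gv (h : Good b a) {m : ℝ} (h2 : m ≤ 2) (hm : muv b a ≤ m) : fv a m ≤ gv b m := by
  obtain ⟨hμ1, hμ2, he⟩ := h.muv_spec
  rcases hm.eq_or_lt with rfl | hlt
  · exact he.le
  · linarith [fv_anti h.ones hμ1 hlt h2, gv_mono b hμ1 hlt]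

theorem gv_le_fv (h : Good b a) {m : ℝ} (h1 : 1 < m) (hm : m ≤ muv b a) : gv b m ≤ fv a m := by
  obtain ⟨hμ1, hμ2, he⟩ := h.muv_spec
  rcases hm.eq_or_lt with rfl | hlt
  · exact he.ge
  · linarith [fv_anti h.ones h1 hlt hμ2, gv_mono b h1 hlt]

end Good

/-! ### Expansions over `{0, 1, m}` -/

section
variable {β m : ℝ}

theorem piR_summable (hβ : 1 < β) (hm : 1 < m) {v : ℕ → ℝ} (hv : ∀ k, v k ∈ ({0, 1, m} : Set ℝ)) :
    Summable fun k : ℕ => v k / β ^ (k + 1) := by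
  obtain ⟨q0, q1⟩ := inv_bounds hβ
  have hs := (summable_geometric_of_lt_one q0.le q1).mul_left m
  have hk : ∀ k, 0 ≤ v k ∧ v k ≤ m := fun k => by
    rcases hv k with h | h | h <;> rw [h] <;> constructor <;> linarith
  refine Summable.of_nonneg_of_le (fun k => div_nonneg (hk k).1 (by positivity)) (fun k => ?_) hs
  rw [div_eq_mul_inv, ← inv_pow]
  refine mul_le_mul (hk k).2 ?_ (by positivity) (by linarith)
  exact pow_le_pow_of_le_one q0.le q1.le (by omega)

theorem piR_rec (hβ : 1 < β) (hm : 1 < m) {v : ℕ → ℝ} (hv : ∀ k, v k ∈ ({0, 1, m} : Set ℝ)) :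
    β * piR β v = v 0 + piR β (fun k => v (k + 1)) := by
  have : β ≠ 0 := by linarith
  rw [piR, (piR_summable hβ hm hv).tsum_eq_zero_add, mul_add, ← tsum_mul_left, piR]
  congr 1
  · field_simp
    simp [mul_comm]
  · refine tsum_congr fun k => ?_
    field_simp
    ring

theorem piR_nonneg (hβ : 1 < β) (hm : 1 < m) {v : ℕ → ℝ}
    (hv : ∀ k, v k ∈ ({0, 1, m} : Set ℝ)) : 0 ≤ piR β v :=
  tsum_nonneg fun k => div_nonneg
    (by rcases hv k with h | h | h <;> rw [h] <;> linarith) (by positivity)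

theorem piR_le (hβ : 1 < β) (hm : 1 < m) {v : ℕ → ℝ}
    (hv : ∀ k, v k ∈ ({0, 1, m} : Set ℝ)) : piR β v ≤ m / (β - 1) := by
  obtain ⟨q0, q1⟩ := inv_bounds hβ
  have hs := ((summable_geometric_of_lt_one q0.le q1).mul_left (m * β⁻¹))
  have he : m / (β - 1) = ∑' k : ℕ, m * β⁻¹ * β⁻¹ ^ k := by
    rw [tsum_mul_left, tsum_geometric_of_lt_one q0.le q1]
    have : β - 1 ≠ 0 := by linarith
    have : β ≠ 0 := by linarith
    rw [show 1 - β⁻¹ = (β - 1) / β by field_simp, inv_div]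
    field_simp
  rw [he]
  refine (piR_summable hβ hm hv).tsum_le_tsum (fun k => ?_) hs
  rw [div_eq_mul_inv, ← inv_pow, pow_succ', mul_assoc]
  refine mul_le_mul_of_nonneg_right ?_ (by positivity)
  rcases hv k with h | h | h <;> rw [h] <;> linarith

theorem bR_mem (m : ℝ) (u : ℕ → Bool) (k : ℕ) : bR u k ∈ ({0, 1, m} : Set ℝ) := by
  unfold bR; split_ifs <;> simp

theorem piR_bR (β : ℝ) (u : ℕ → Bool) : piR β (bR u) = piB β u := rfl

/-- Greedy digits of an expansion over `{0, 1, m}`. -/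
noncomputable def digit (β m y : ℝ) : ℝ := if m ≤ β * y then m else if 1 ≤ β * y then 1 else 0

/-- Remainders of the greedy expansion. -/
noncomputable def remainder (β m y : ℝ) : ℕ → ℝ
  | 0 => y
  | n + 1 => β * remainder β m y n - digit β m (remainder β m y n)

theorem exists_expansion (hβ : 1 < β) (hm : 1 < m) (hm2 : m ≤ 2) (hβm : β ≤ 1 + m) {y : ℝ}
    (h0 : 0 ≤ y) (h1 : y ≤ m / (β - 1)) :
    ∃ v : ℕ → ℝ, (∀ k, v k ∈ ({0, 1, m} : Set ℝ)) ∧ piR β v = y := by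
  have hM : (β - 1) * (m / (β - 1)) = m := mul_div_cancel₀ _ (by linarith)
  have hM1 : 1 ≤ m / (β - 1) := by rw [one_le_div (by linarith)]; linarith
  set M := m / (β - 1)
  set r := remainder β m y
  have hr : ∀ n, 0 ≤ r n ∧ r n ≤ M := by
    intro n
    induction n with
    | zero => exact ⟨h0, h1⟩
    | succ n ih =>
      change 0 ≤ β * r n - digit β m (r n) ∧ β * r n - digit β m (r n) ≤ M
      have : β * r n ≤ β * M := mul_le_mul_of_nonneg_left ih.2 (by linarith)
      have : 0 ≤ β * r n := mul_nonneg (by linarith) ih.1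
      unfold digit
      split_ifs <;> constructor <;> linarith
  have hd : ∀ k, digit β m (r k) ∈ ({0, 1, m} : Set ℝ) := fun k => by
    unfold digit; split_ifs <;> simp
  refine ⟨fun k => digit β m (r k), hd, ?_⟩
  have hfin : ∀ n, y = ∑ k ∈ Finset.range n, digit β m (r k) / β ^ (k + 1) + r n / β ^ n := by
    intro n
    induction n with
    | zero => simp [r, remainder]
    | succ n ih =>
      rw [Finset.sum_range_succ, ih, add_assoc]
      congr 1
      have : β ≠ 0 := by linarith
      change r n / β ^ n = _ + (β * r n - digit β m (r n)) / β ^ (n + 1)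
      field_simp
      ring
  have hlim : Filter.Tendsto (fun n => r n / β ^ n) Filter.atTop (nhds 0) := by
    obtain ⟨q0, q1⟩ := inv_bounds hβ
    have hz : Filter.Tendsto (fun n : ℕ => M * β⁻¹ ^ n) Filter.atTop (nhds 0) := by
      simpa using (tendsto_pow_atTop_nhds_zero_of_lt_one q0.le q1).const_mul M
    refine squeeze_zero (fun n => div_nonneg (hr n).1 (by positivity)) (fun n => ?_) hz
    rw [div_eq_mul_inv, ← inv_pow]
    exact mul_le_mul_of_nonneg_right (hr n).2 (by positivity)
  have ht := (piR_summable hβ hm hd).hasSum.tendsto_sum_nat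
  refine tendsto_nhds_unique ht ?_
  have : (fun n => ∑ k ∈ Finset.range n, digit β m (r k) / β ^ (k + 1))
      = fun n => y - r n / β ^ n := funext fun n => by linarith [hfin n]
  rw [this]
  simpa using tendsto_const_nhds.sub hlim

theorem piR_eq_of_prefix (hβ : 1 < β) (hm : 1 < m) {v w : ℕ → ℝ}
    (hv : ∀ k, v k ∈ ({0, 1, m} : Set ℝ)) (hw : ∀ k, w k ∈ ({0, 1, m} : Set ℝ)) {n : ℕ}
    (h : ∀ i, i < n → v i = w i) :
    piR β v = piR β w ↔ piR β (fun k => v (k + n)) = piR β fun k => w (k + n) := by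
  induction n generalizing v w with
  | zero => rfl
  | succ n ih =>
    have h1 := piR_rec hβ hm hv
    have h2 := piR_rec hβ hm hw
    have h3 := ih (fun k => hv (k + 1)) (fun k => hw (k + 1))
      (fun i hi => h (i + 1) (by omega))
    have e : ∀ x : ℕ → ℝ, (fun k => x (k + (n + 1))) = fun k => x (k + n + 1) := fun x => rfl
    rw [e, e, ← h3]
    have h0 := h 0 (by omega)
    constructor
    · intro hc; rw [hc] at h1; linarith
    · intro hc
      have : β * piR β v = β * piR β w := by rw [h1, h2, h0, hc]
      exact mul_left_cancel₀ (by linarith) this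

/-- A sufficient condition for unique expansions. -/
theorem mem_Uset (hβ : 1 < β) (hm : 1 < m) {x : ℕ → Bool}
    (h0 : ∀ k, x k = false → piB β (sh (k + 1) x) < 1)
    (h1 : ∀ k, x k = true → piB β (sh (k + 1) x) < m - 1 ∧
      m / (β - 1) - 1 < piB β (sh (k + 1) x)) : bR x ∈ Uset β {0, 1, m} := by
  refine ⟨bR_mem m x, fun v hv hne heq => ?_⟩
  obtain ⟨n, hn, hlt⟩ : ∃ n, v n ≠ bR x n ∧ ∀ i, i < n → v i = bR x i := by
    classical
    have hex : ∃ n, v n ≠ bR x n := by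
      by_contra hc; push Not at hc; exact hne (funext hc)
    exact ⟨Nat.find hex, Nat.find_spec hex, fun i hi => by simpa using Nat.find_min hex hi⟩
  rw [piR_eq_of_prefix hβ hm hv (bR_mem m x) hlt] at heq
  have e1 := piR_rec hβ hm (fun k => hv (k + n))
  have e2 := piR_rec hβ hm (fun k => bR_mem m x (k + n))
  rw [heq, e2] at e1
  have e3 : piR β (fun k => bR x (k + 1 + n)) = piB β (sh (n + 1) x) := by
    rw [← piR_bR]; congr 1; funext k; simp only [bR, sh_apply]
    rw [show k + 1 + n = k + (n + 1) by omega]; rfl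
  have hn0 := piR_nonneg hβ hm (fun k => hv (k + 1 + n))
  have hn1 := piR_le hβ hm (fun k => hv (k + 1 + n))
  simp only [Nat.zero_add] at e1
  rw [e3] at e1
  cases hx : x n with
  | false =>
    have hb : bR x n = 0 := by simp [bR, hx]
    rw [hb] at e1 hn
    have := h0 n hx
    rcases hv n with h | h | h
    · exact hn h
    · rw [h] at e1; linarith
    · rw [Set.mem_singleton_iff.1 h] at e1; linarith
  | true =>
    have hb : bR x n = 1 := by simp [bR, hx]
    rw [hb] at e1 hn
    have := h1 n hx
    rcases hv n with h | h | h
    · rw [h] at e1; linarith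
    · exact hn h
    · rw [Set.mem_singleton_iff.1 h] at e1; linarith

/-- A necessary condition for unique expansions. -/
theorem of_mem_Uset (hβ : 1 < β) (hm : 1 < m) (hm2 : m ≤ 2) (hβm : β ≤ 1 + m) {x : ℕ → Bool}
    (hx : bR x ∈ Uset β {0, 1, m}) {k : ℕ} (hk : x k = true) :
    piB β (sh (k + 1) x) < m - 1 ∧ m / (β - 1) - 1 < piB β (sh (k + 1) x) := by
  have hnn : 0 ≤ piB β (sh (k + 1) x) := piR_nonneg hβ hm (bR_mem m _)
  have hle : piB β (sh (k + 1) x) ≤ m / (β - 1) := piR_le hβ hm (bR_mem m _)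
  have key : ∀ d ∈ ({0, 1, m} : Set ℝ), d ≠ 1 → 0 ≤ piB β (sh (k + 1) x) + 1 - d →
      piB β (sh (k + 1) x) + 1 - d ≤ m / (β - 1) → False := by
    intro d hd hd1 hy0 hy1
    obtain ⟨v, hv, hvy⟩ := exists_expansion hβ hm hm2 hβm hy0 hy1
    set w : ℕ → ℝ := fun i => if i < k then bR x i else if i = k then d else v (i - (k + 1))
    have hw : ∀ i, w i ∈ ({0, 1, m} : Set ℝ) := fun i => by
      simp only [w]; split_ifs
      · exact bR_mem m x i
      · exact hd
      · exact hv _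
    have hbk : bR x k = 1 := by simp [bR, hk]
    have hwk : w k = d := by simp [w]
    refine hx.2 w hw (fun hc => hd1 ?_) ?_
    · rw [← hwk, hc, hbk]
    · rw [piR_eq_of_prefix hβ hm hw (bR_mem m x) (n := k) (fun i hi => by simp [w, hi])]
      have e1 := piR_rec hβ hm (fun i => hw (i + k))
      have e2 := piR_rec hβ hm (fun i => bR_mem m x (i + k))
      have e3 : piR β (fun i => bR x (i + 1 + k)) = piB β (sh (k + 1) x) := by
        rw [← piR_bR]; congr 1; funext i; simp only [bR, sh_apply]
        rw [show i + 1 + k = i + (k + 1) by omega]; rfl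
      have e4 : (fun i => w (i + 1 + k)) = v := by
        funext i
        simp only [w]
        rw [if_neg (by omega), if_neg (by omega)]
        congr 1; omega
      simp only [Nat.zero_add] at e1 e2
      rw [hwk, e4, hvy] at e1
      rw [hbk, e3] at e2
      exact mul_left_cancel₀ (by linarith : β ≠ 0) (by rw [e1, e2]; ring)
  constructor
  · by_contra hc
    exact key m (by simp) (by linarith) (by linarith) (by linarith)
  · by_contra hc
    exact key 0 (by simp) (by norm_num) (by linarith) (by linarith)

/-- Binary words with unique expansions, as a set of binary words. -/
def binU (β m : ℝ) : Set (ℕ → Bool) := {x | bR x ∈ Uset β {0, 1, m}}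

theorem bR_injective : Function.Injective bR := fun u v h => by
  funext k
  have := congrFun h k
  simp only [bR] at this
  cases hu : u k <;> cases hv : v k <;> simp_all

theorem countable_iff_binU (β m : ℝ) :
    (Uset β {0, 1, m} ∩ {v | ∃ u : ℕ → Bool, v = bR u}).Countable ↔ (binU β m).Countable := by
  have : Uset β {0, 1, m} ∩ {v | ∃ u : ℕ → Bool, v = bR u} = bR '' binU β m := by
    ext v
    constructor
    · rintro ⟨hv, u, rfl⟩; exact ⟨u, hv, rfl⟩
    · rintro ⟨u, hu, rfl⟩; exact ⟨hu, u, rfl⟩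
  rw [this]
  exact ⟨fun h => Set.countable_of_injective_of_countable_image bR_injective.injOn h,
    fun h => h.image _⟩

theorem Lval_eq {L : ℝ} (hL : 1 < L) (h1 : ∀ β, L < β → ¬ (binU β m).Countable)
    (h2 : ∀ β, 1 < β → β < L → (binU β m).Countable) : Lval m = L := by
  unfold Lval
  simp only [countable_iff_binU]
  refine csInf_eq_of_forall_ge_of_forall_gt_exists_lt
    ⟨L + 1, by linarith, h1 _ (by linarith)⟩ ?_ ?_
  · rintro β ⟨hβ, hc⟩
    by_contra hlt
    exact hc (h2 β hβ (not_le.1 hlt))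
  · intro w hw
    exact ⟨(L + w) / 2, ⟨by linarith, h1 _ (by linarith)⟩, by linarith⟩

/-- The binary words whose suffixes lie between `b` and `a`. -/
def Between (b a : ℕ → Bool) (x : ℕ → Bool) : Prop :=
  ∀ k, toLex b ≤ toLex (sh k x) ∧ toLex (sh k x) ≤ toLex a

/-- The binary words whose suffixes lie strictly between `b` and `a`. -/
def StrictBetween (b a : ℕ → Bool) (x : ℕ → Bool) : Prop :=
  ∀ k, toLex b < toLex (sh k x) ∧ toLex (sh k x) < toLex a

theorem mem_binU_of_between (hβ : 2 < β) (hm : 1 < m) (hm2 : m ≤ 2) {b a x : ℕ → Bool}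
    (hF : F β a < m) (hG : m < G β b) (hx : Between b a x) : x ∈ binU β m := by
  have hβ1 : 1 < β := by linarith
  have hFk : ∀ k, F β (sh k x) < m := fun k => (F_lex_le hβ.le (hx k).2).trans_lt hF
  have hGk : ∀ k, m < G β (sh k x) := fun k => hG.trans_le (G_lex_le hβ.le (hx k).1)
  refine mem_Uset hβ1 hm (fun k _ => ?_) (fun k hk => ⟨?_, ?_⟩)
  · have := hFk (k + 1)
    rw [F] at this
    nlinarith
  · have := hFk k
    rw [sh_eq_consB, hk, F_true hβ1] at this
    linarith
  · have := hGk (k + 1)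
    rw [G] at this
    rw [sub_lt_iff_lt_add, div_lt_iff₀ (by linarith)]
    linarith

theorem between_of_mem_binU (hβ : 2 < β) (hm : 1 < m) (hm2 : m ≤ 2) (hβm : β ≤ 1 + m)
    {x : ℕ → Bool} (hx : x ∈ binU β m) {k : ℕ} (hk : x k = true) :
    F β (sh k x) < m ∧ m < G β (sh (k + 1) x) := by
  have hβ1 : 1 < β := by linarith
  obtain ⟨h1, h2⟩ := of_mem_Uset hβ1 hm hm2 hβm hx hk
  constructor
  · rw [sh_eq_consB, hk, F_true hβ1]; linarith
  · rw [sub_lt_iff_lt_add, div_lt_iff₀ (by linarith)] at h2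
    rw [G]; linarith

theorem binU_countable_of_le_two (hβ : 1 < β) (hβ2 : β ≤ 2) (hm : 1 < m) (hm2 : m ≤ 2) :
    (binU β m).Countable := by
  refine (Set.countable_singleton w0bar).mono fun x hx => ?_
  refine funext fun k => ?_
  by_contra hk
  have hk' : x k = true := by simpa [w0bar] using hk
  obtain ⟨h1, h2⟩ := of_mem_Uset hβ hm hm2 (by linarith) hx hk'
  rw [sub_lt_iff_lt_add, div_lt_iff₀ (by linarith)] at h2
  nlinarith

theorem countable_of_suffix {S T : Set (ℕ → Bool)} (hT : T.Countable)
    (h : ∀ x ∈ S, ∃ k, sh k x ∈ T) : S.Countable := by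
  have : S ⊆ ⋃ p : List Bool, (fun y : ℕ → Bool => p.foldr consB y) '' T := by
    intro x hx
    obtain ⟨k, hk⟩ := h x hx
    have key : ∀ k x, ∃ p : List Bool, p.foldr consB (sh k x) = x := by
      intro k
      induction k with
      | zero => exact fun x => ⟨[], rfl⟩
      | succ k ih =>
        intro x
        obtain ⟨p, hp⟩ := ih (sh 1 x)
        refine ⟨x 0 :: p, ?_⟩
        rw [sh_sh] at hp
        rw [List.foldr_cons, hp, consB_sh_one]
    obtain ⟨p, hp⟩ := key k x
    exact Set.mem_iUnion.2 ⟨p, _, hk, hp⟩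
  exact (Set.countable_iUnion fun p => hT.image _).mono this

theorem binU_countable_of_suffix {T : Set (ℕ → Bool)} (hT : T.Countable)
    (h : ∀ x ∈ binU β m, ∀ k, x k = true → ∃ j, sh j x ∈ T) : (binU β m).Countable := by
  refine countable_of_suffix (hT.union (Set.countable_singleton w0bar)) fun x hx => ?_
  by_cases hk : ∃ k, x k = true
  · obtain ⟨k, hk⟩ := hk
    obtain ⟨j, hj⟩ := h x hx k hk
    exact ⟨j, Or.inl hj⟩
  · push Not at hk
    exact ⟨0, Or.inr (funext fun k => by simpa [w0bar] using hk k)⟩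

/-- If every suffix following a `1` is larger than `b`, then so are all suffixes of the rest. -/
theorem lt_suffix_of_lt_after_one {b x : ℕ → Bool} {k : ℕ} (hk : x k = true)
    (h : ∀ i, x i = true → toLex b < toLex (sh (i + 1) x)) (j : ℕ) :
    toLex b < toLex (sh j (sh (k + 1) x)) := by
  rw [sh_sh]
  induction j with
  | zero => rw [Nat.zero_add]; exact h k hk
  | succ j ih =>
    have e : j + 1 + (k + 1) = j + (k + 1) + 1 := by omega
    rw [e]
    cases hx : x (j + (k + 1)) with
    | true => exact h _ hx
    | false =>
      refine ih.trans_le ?_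
      rw [sh_eq_consB, hx]
      exact lex_consB_false_le _

theorem binU_countable (hβ : 2 < β) (hm : 1 < m) (hm2 : m ≤ 2) (hβm : β ≤ 1 + m)
    {b a : ℕ → Bool} (ha : a 0 = true) (hF : m ≤ F β a) (hG : G β b ≤ m)
    (hc : {x | StrictBetween b a x}.Countable) : (binU β m).Countable := by
  refine binU_countable_of_suffix hc fun x hx k hk => ⟨k + 1, ?_⟩
  have hlo : ∀ i, x i = true → toLex b < toLex (sh (i + 1) x) := fun i hi => by
    by_contra h
    have := (between_of_mem_binU hβ hm hm2 hβm hx hi).2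
    linarith [G_lex_le hβ.le (not_lt.1 h)]
  refine fun j => ⟨lt_suffix_of_lt_after_one hk hlo j, ?_⟩
  rw [sh_sh]
  cases hj : x (j + (k + 1)) with
  | true =>
    by_contra h
    have := (between_of_mem_binU hβ hm hm2 hβm hx hj).1
    linarith [F_lex_le hβ.le (not_lt.1 h)]
  | false =>
    rw [sh_eq_consB, hj, ← consB_sh_one a, ha]
    exact lex_false_true _ _

end

/-! ### Substitutions acting on infinite words -/

theorem foldr_consB_apply (l : List Bool) (v : ℕ → Bool) (n : ℕ) :
    l.foldr consB v n = if n < l.length then l.getD n false else v (n - l.length) := by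
  induction l generalizing n with
  | nil => simp
  | cons c l ih =>
    cases n with
    | zero => simp
    | succ n => simp [ih]

section Subst

variable {σ τ : Bool → List Bool}

theorem substApply_apply (u : ℕ → Bool) {n K : ℕ}
    (h1 : ∑ i ∈ Finset.range K, (σ (u i)).length ≤ n)
    (h2 : n < ∑ i ∈ Finset.range (K + 1), (σ (u i)).length) :
    substApply σ u n = (σ (u K)).getD (n - ∑ i ∈ Finset.range K, (σ (u i)).length) false := by
  have hK : sSup {k : ℕ | (∑ i ∈ Finset.range k, (σ (u i)).length) ≤ n} = K := by
    refine IsGreatest.csSup_eq ⟨h1, fun k hk => ?_⟩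
    by_contra hlt
    have hsub : Finset.range (K + 1) ⊆ Finset.range k := Finset.range_subset_range.2 (by omega)
    have := Finset.sum_le_sum_of_subset (f := fun i => (σ (u i)).length) hsub
    have hk' : ∑ i ∈ Finset.range k, (σ (u i)).length ≤ n := hk
    omega
  simp only [substApply, hK]

theorem exists_block (hσ : ∀ c, σ c ≠ []) (u : ℕ → Bool) (n : ℕ) :
    ∃ K, ∑ i ∈ Finset.range K, (σ (u i)).length ≤ n ∧
      n < ∑ i ∈ Finset.range (K + 1), (σ (u i)).length := by
  induction n with
  | zero =>
    refine ⟨0, by simp, ?_⟩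
    simpa using List.length_pos_of_ne_nil (hσ (u 0))
  | succ n ih =>
    obtain ⟨K, h1, h2⟩ := ih
    by_cases h : n + 1 < ∑ i ∈ Finset.range (K + 1), (σ (u i)).length
    · exact ⟨K, by omega, h⟩
    · refine ⟨K + 1, by omega, ?_⟩
      rw [Finset.sum_range_succ]
      have := List.length_pos_of_ne_nil (hσ (u (K + 1)))
      omega

theorem substApply_consB (hσ : ∀ c, σ c ≠ []) (c : Bool) (u : ℕ → Bool) :
    substApply σ (consB c u) = (σ c).foldr consB (substApply σ u) := by
  funext n
  rw [foldr_consB_apply]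
  split_ifs with h
  · rw [substApply_apply (consB c u) (K := 0) (by simp) (by simpa using h)]
    simp
  · obtain ⟨K, h1, h2⟩ := exists_block hσ u (n - (σ c).length)
    have e : ∀ K, ∑ i ∈ Finset.range (K + 1), (σ (consB c u i)).length =
        ∑ i ∈ Finset.range K, (σ (u i)).length + (σ c).length := fun K => by
      rw [Finset.sum_range_succ']; rfl
    rw [substApply_apply u h1 h2,
      substApply_apply (consB c u) (K := K + 1) (by rw [e]; omega) (by rw [e]; omega), e]
    simp only [consB_succ]
    congr 1
    omega

theorem eq_of_consB_eq (hσ : ∀ c, σ c ≠ []) {f g : (ℕ → Bool) → ℕ → Bool}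
    (hf : ∀ c u, f (consB c u) = (σ c).foldr consB (f u))
    (hg : ∀ c u, g (consB c u) = (σ c).foldr consB (g u)) : f = g := by
  suffices H : ∀ n u, f u n = g u n by funext u n; exact H n u
  intro n
  induction n using Nat.strong_induction_on with
  | _ n ih =>
    intro u
    rw [← consB_sh_one u, hf, hg, foldr_consB_apply, foldr_consB_apply]
    have := List.length_pos_of_ne_nil (hσ (u 0))
    split_ifs with h
    · rfl
    · exact ih _ (by omega) _

theorem substApply_foldr (hσ : ∀ c, σ c ≠ []) (l : List Bool) (u : ℕ → Bool) :
    substApply σ (l.foldr consB u) = (l.flatMap σ).foldr consB (substApply σ u) := by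
  induction l with
  | nil => simp
  | cons c l ih => simp [substApply_consB hσ, ih]

theorem compSub_ne_nil (hσ : ∀ c, σ c ≠ []) (hτ : ∀ c, τ c ≠ []) (c : Bool) :
    compSub σ τ c ≠ [] := by
  intro h
  obtain ⟨d, hd⟩ := List.exists_mem_of_ne_nil _ (hτ c)
  exact hσ d (List.flatMap_eq_nil_iff.1 h d hd)

theorem substApply_compSub (hσ : ∀ c, σ c ≠ []) (hτ : ∀ c, τ c ≠ []) (u : ℕ → Bool) :
    substApply (compSub σ τ) u = substApply σ (substApply τ u) := by
  refine congrFun (eq_of_consB_eq (f := substApply (compSub σ τ))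
    (g := fun u => substApply σ (substApply τ u)) (compSub_ne_nil hσ hτ)
    (substApply_consB (compSub_ne_nil hσ hτ)) fun c u => ?_) u
  simp only [substApply_consB hτ, substApply_foldr hσ]
  rfl

theorem substApply_idSub (u : ℕ → Bool) : substApply idSub u = u :=
  congrFun (eq_of_consB_eq (σ := idSub) (f := substApply idSub) (g := id) (by simp [idSub])
    (substApply_consB (by simp [idSub])) (by simp [idSub])) u

end Subst

/-- The three generating substitutions. -/
inductive Gen
  | L
  | M
  | R

/-- The substitution named by a generator. -/
def Gen.sub : Gen → Bool → List Bool
  | .L => Lsub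
  | .M => Msub
  | .R => Rsub

theorem Gen.sub_ne_nil (g : Gen) (c : Bool) : g.sub c ≠ [] := by
  cases g <;> cases c <;> simp [Gen.sub, Lsub, Msub, Rsub]

/-- The action of a generator on infinite words. -/
noncomputable def act (g : Gen) (u : ℕ → Bool) : ℕ → Bool := substApply g.sub u

theorem act_consB (g : Gen) (c : Bool) (u : ℕ → Bool) :
    act g (consB c u) = (g.sub c).foldr consB (act g u) := substApply_consB g.sub_ne_nil c u

@[simp] theorem act_L_false (u : ℕ → Bool) :
    act .L (consB false u) = consB false (act .L u) := act_consB _ _ _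
@[simp] theorem act_L_true (u : ℕ → Bool) :
    act .L (consB true u) = consB false (consB true (act .L u)) := act_consB _ _ _
@[simp] theorem act_M_false (u : ℕ → Bool) :
    act .M (consB false u) = consB false (consB true (act .M u)) := act_consB _ _ _
@[simp] theorem act_M_true (u : ℕ → Bool) :
    act .M (consB true u) = consB true (consB false (act .M u)) := act_consB _ _ _
@[simp] theorem act_R_false (u : ℕ → Bool) :
    act .R (consB false u) = consB false (consB true (act .R u)) := act_consB _ _ _
@[simp] theorem act_R_true (u : ℕ → Bool) :
    act .R (consB true u) = consB true (act .R u) := act_consB _ _ _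

theorem exists_consB (u : ℕ → Bool) : ∃ c v, u = consB c v := ⟨u 0, sh 1 u, (consB_sh_one u).symm⟩

theorem act_L_eq (u : ℕ → Bool) : act .L u = consB false (sh 1 (act .L u)) := by
  obtain ⟨c, v, rfl⟩ := exists_consB u
  cases c <;> simp [sh_one_consB]

theorem act_strictMono (g : Gen) {u v : ℕ → Bool} (h : toLex u < toLex v) :
    toLex (act g u) < toLex (act g v) := by
  refine lex_lt_induction (P := fun u v => toLex (act g u) < toLex (act g v)) ?_ ?_ h
  · intro u v
    cases g
    · rw [act_L_false, act_L_true, lex_consB_lt, act_L_eq]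
      exact lex_false_true _ _
    · rw [act_M_false, act_M_true]; exact lex_false_true _ _
    · rw [act_R_false, act_R_true]; exact lex_false_true _ _
  · intro c u v huv
    cases g <;> cases c <;> simpa using huv

theorem act_mono (g : Gen) {u v : ℕ → Bool} (h : toLex u ≤ toLex v) :
    toLex (act g u) ≤ toLex (act g v) := by
  rcases h.lt_or_eq with h | h
  · exact (act_strictMono g h).le
  · rw [toLex_inj.1 h]

theorem act_injective (g : Gen) : Function.Injective (act g) := fun u v h => by
  rcases lt_trichotomy (toLex u) (toLex v) with h' | h' | h'
  · exact absurd h (toLex_inj.not.1 (act_strictMono g h').ne)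
  · exact toLex_inj.1 h'
  · exact absurd h (toLex_inj.not.1 (act_strictMono g h').ne')

theorem act_lt_iff {g : Gen} {u v : ℕ → Bool} :
    toLex (act g u) < toLex (act g v) ↔ toLex u < toLex v :=
  ⟨fun h => not_le.1 fun h' => (act_mono g h').not_gt h, act_strictMono g⟩

theorem act_agree (g : Gen) {N : ℕ} {u v : ℕ → Bool} (h : agree N u v) :
    agree N (act g u) (act g v) := by
  induction N generalizing u v with
  | zero => exact fun i hi => absurd hi (by omega)
  | succ N ih =>
    have h0 : u 0 = v 0 := h 0 (by omega)
    have := ih h.sh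
    rw [← consB_sh_one u, ← consB_sh_one v, ← h0]
    cases g <;> cases u 0 <;> simp only [act_L_false, act_L_true, act_M_false, act_M_true,
      act_R_false, act_R_true] <;>
      first
        | exact this.consB _
        | exact ((this.consB _).consB _).mono (by omega)

theorem act_L_agree {N : ℕ} {u v : ℕ → Bool} (h : agree N u v) :
    agree (N + 1) (act .L u) (act .L v) := by
  induction N generalizing u v with
  | zero =>
    rw [act_L_eq u, act_L_eq v]
    exact agree.consB (fun i hi => absurd hi (by omega)) _
  | succ N ih =>
    have h0 : u 0 = v 0 := h 0 (by omega)
    have := ih h.sh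
    rw [← consB_sh_one u, ← consB_sh_one v, ← h0]
    cases u 0 <;> simp only [act_L_false, act_L_true]
    · exact this.consB _
    · exact ((this.consB _).consB _).mono (by omega)

/-- The lower endpoint induced by a generator. -/
noncomputable def lo (g : Gen) (b : ℕ → Bool) : ℕ → Bool :=
  match g with
  | .M => consB false (act .M b)
  | g => act g b

/-- The upper endpoint induced by a generator. -/
noncomputable def hi (g : Gen) (a : ℕ → Bool) : ℕ → Bool :=
  match g with
  | .L => sh 1 (act .L a)
  | g => consB true (act g a)

theorem lo_L (b : ℕ → Bool) : lo .L b = act .L b := rfl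
theorem lo_M (b : ℕ → Bool) : lo .M b = consB false (act .M b) := rfl
theorem lo_R (b : ℕ → Bool) : lo .R b = act .R b := rfl
theorem hi_L (b : ℕ → Bool) : hi .L b = sh 1 (act .L b) := rfl
theorem hi_M (b : ℕ → Bool) : hi .M b = consB true (act .M b) := rfl
theorem hi_R (b : ℕ → Bool) : hi .R b = consB true (act .R b) := rfl

theorem hi_L_true (u : ℕ → Bool) : hi .L (consB true u) = consB true (act .L u) := by
  rw [hi_L, act_L_true, sh_one_consB]

theorem consB_hi_L (u : ℕ → Bool) : consB false (hi .L u) = act .L u := (act_L_eq u).symm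

theorem lo_mono (g : Gen) {u v : ℕ → Bool} (h : toLex u ≤ toLex v) :
    toLex (lo g u) ≤ toLex (lo g v) := by
  cases g
  · exact act_mono _ h
  · rw [lo_M, lo_M, lex_consB_le]; exact act_mono _ h
  · exact act_mono _ h

theorem hi_mono (g : Gen) {u v : ℕ → Bool} (h : toLex u ≤ toLex v) :
    toLex (hi g u) ≤ toLex (hi g v) := by
  cases g
  · rw [← lex_consB_le (c := false), consB_hi_L, consB_hi_L]; exact act_mono _ h
  · rw [hi_M, hi_M, lex_consB_le]; exact act_mono _ h
  · rw [hi_R, hi_R, lex_consB_le]; exact act_mono _ h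

theorem lo_head (g : Gen) {b : ℕ → Bool} (h : b 0 = false) : lo g b 0 = false := by
  rw [← consB_sh_one b, h]
  cases g
  · rw [lo_L, act_L_false]; rfl
  · rfl
  · rw [lo_R, act_R_false]; rfl

theorem hi_head (g : Gen) {a : ℕ → Bool} (h : a 0 = true) : hi g a 0 = true := by
  rw [← consB_sh_one a, h]
  cases g
  · rw [hi_L_true]; rfl
  · rfl
  · rfl

theorem lo_agree (g : Gen) {N : ℕ} {u v : ℕ → Bool} (h : agree N u v) :
    agree N (lo g u) (lo g v) := by
  cases g
  · exact act_agree _ h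
  · exact ((act_agree .M h).consB _).mono (by omega)
  · exact act_agree _ h

theorem hi_agree (g : Gen) {N : ℕ} {u v : ℕ → Bool} (h : agree N u v) :
    agree N (hi g u) (hi g v) := by
  cases g
  · exact (act_L_agree h).sh
  · exact ((act_agree .M h).consB _).mono (by omega)
  · exact ((act_agree .R h).consB _).mono (by omega)

theorem lo_agree_succ (g : Gen) {N : ℕ} {u v : ℕ → Bool} (hu : u 0 = false) (hv : v 0 = false)
    (h : agree N u v) : agree (N + 1) (lo g u) (lo g v) := by
  cases g
  · exact act_L_agree h
  · exact (act_agree .M h).consB _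
  · cases N with
    | zero =>
      intro i hi
      obtain rfl : i = 0 := by omega
      rw [lo_head _ hu, lo_head _ hv]
    | succ N =>
      have := act_agree .R h.sh
      rw [← consB_sh_one u, ← consB_sh_one v, hu, hv, lo_R, lo_R, act_R_false, act_R_false]
      exact (this.consB _).consB _

theorem hi_agree_succ (g : Gen) {N : ℕ} {u v : ℕ → Bool} (hu : u 0 = true) (hv : v 0 = true)
    (h : agree N u v) : agree (N + 1) (hi g u) (hi g v) := by
  cases g
  · cases N with
    | zero =>
      intro i hi
      obtain rfl : i = 0 := by omega
      rw [hi_head _ hu, hi_head _ hv]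
    | succ N =>
      have := act_L_agree h.sh
      rw [← consB_sh_one u, ← consB_sh_one v, hu, hv, hi_L_true, hi_L_true]
      exact this.consB _
  · exact (act_agree .M h).consB _
  · exact (act_agree .R h).consB _

theorem sh_act (g : Gen) (u : ℕ → Bool) (k : ℕ) : ∃ j, sh j (act g u) = act g (sh k u) := by
  induction k with
  | zero => exact ⟨0, rfl⟩
  | succ k ih =>
    obtain ⟨j, hj⟩ := ih
    rw [sh_eq_consB k u] at hj
    have h1 : ∀ {c v}, sh j (act g u) = consB c v → sh (j + 1) (act g u) = v := fun h => by
      rw [Nat.add_comm, ← sh_sh, h, sh_one_consB]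
    have h2 : ∀ {c d v}, sh j (act g u) = consB c (consB d v) → sh (j + 2) (act g u) = v :=
      fun h => by rw [Nat.add_comm, ← sh_sh, h]; rfl
    cases g <;> cases hc : u k <;> simp only [hc, act_L_false, act_L_true, act_M_false, act_M_true,
      act_R_false, act_R_true] at hj <;>
      first
        | exact ⟨_, h2 hj⟩
        | exact ⟨_, h1 hj⟩

theorem sh_act_cases (g : Gen) (u : ℕ → Bool) (k : ℕ) :
    (∃ j, sh k (act g u) = act g (sh j u)) ∨
      ∃ j c d, g.sub (u j) = [c, d] ∧ sh k (act g u) = consB d (act g (sh (j + 1) u)) := by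
  induction k with
  | zero => exact Or.inl ⟨0, rfl⟩
  | succ k ih =>
    rcases ih with ⟨j, hj⟩ | ⟨j, c, d, -, hj⟩
    · rw [sh_eq_consB j u, act_consB] at hj
      rw [Nat.add_comm, ← sh_sh, hj]
      rcases hg : g.sub (u j) with _ | ⟨c, _ | ⟨d, _ | ⟨e, l⟩⟩⟩
      · exact absurd hg (g.sub_ne_nil _)
      · exact Or.inl ⟨j + 1, rfl⟩
      · exact Or.inr ⟨j, c, d, hg, rfl⟩
      · exfalso
        revert hg
        cases g <;> cases u j <;> simp [Gen.sub, Lsub, Msub, Rsub]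
    · rw [Nat.add_comm, ← sh_sh, hj]
      exact Or.inl ⟨j + 1, rfl⟩

theorem exists_sh_eq_lo (g : Gen) {u : ℕ → Bool} {k : ℕ} (h : u k = true) :
    ∃ j, act g u j = true ∧ sh (j + 1) (act g u) = lo g (sh (k + 1) u) := by
  obtain ⟨j, hj⟩ := sh_act g u k
  rw [sh_eq_consB k u, h] at hj
  cases g
  · rw [act_L_true] at hj
    refine ⟨j + 1, ?_, ?_⟩
    · simpa [sh_apply, Nat.add_comm] using congrFun hj 1
    · rw [show j + 1 + 1 = 2 + j by omega, ← sh_sh, hj]; rfl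
  · rw [act_M_true] at hj
    refine ⟨j, ?_, ?_⟩
    · simpa [sh_apply] using congrFun hj 0
    · rw [Nat.add_comm, ← sh_sh, hj]; rfl
  · rw [act_R_true] at hj
    refine ⟨j, ?_, ?_⟩
    · simpa [sh_apply] using congrFun hj 0
    · rw [Nat.add_comm, ← sh_sh, hj]; rfl

theorem exists_sh_eq_hi (g : Gen) {u : ℕ → Bool} {k : ℕ} (h : u k = false)
    (h1 : u (k + 1) = true) :
    ∃ j, act g u j = false ∧ sh (j + 1) (act g u) = hi g (sh (k + 1) u) := by
  obtain ⟨j, hj⟩ := sh_act g u k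
  rw [sh_eq_consB k u, h] at hj
  cases g
  · rw [act_L_false, sh_eq_consB (k + 1) u, h1, act_L_true] at hj
    refine ⟨j + 1, ?_, ?_⟩
    · simpa [sh_apply, Nat.add_comm] using congrFun hj 1
    · rw [show j + 1 + 1 = 2 + j by omega, ← sh_sh, hj, sh_eq_consB (k + 1) u, h1, hi_L_true]
      rfl
  · rw [act_M_false] at hj
    refine ⟨j, ?_, ?_⟩
    · simpa [sh_apply] using congrFun hj 0
    · rw [Nat.add_comm, ← sh_sh, hj]; rfl
  · rw [act_R_false] at hj
    refine ⟨j, ?_, ?_⟩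
    · simpa [sh_apply] using congrFun hj 0
    · rw [Nat.add_comm, ← sh_sh, hj]; rfl

theorem act_between (g : Gen) {b a u : ℕ → Bool} (h : Between b a u) :
    Between (lo g b) (hi g a) (act g u) := by
  intro k
  rcases sh_act_cases g u k with ⟨j, hj⟩ | ⟨j, c, d, hs, hj⟩
  · rw [hj]
    obtain ⟨h1, h2⟩ := h j
    cases g
    · refine ⟨act_mono _ h1, ?_⟩
      refine le_trans ?_ (hi_mono .L h2)
      rw [← consB_hi_L]
      exact lex_consB_false_le _
    · exact ⟨(lex_consB_false_le _).trans (act_mono _ h1),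
        (act_mono _ h2).trans (lex_le_consB_true _)⟩
    · exact ⟨act_mono _ h1, (act_mono _ h2).trans (lex_le_consB_true _)⟩
  · rw [hj]
    obtain ⟨h1, h2⟩ := h (j + 1)
    obtain ⟨-, h3⟩ := h j
    rw [sh_eq_consB j u] at h3
    cases g <;> cases hc : u j <;> rw [hc] at hs h3 <;> simp [Gen.sub, Lsub, Msub, Rsub] at hs <;>
      obtain ⟨rfl, rfl⟩ := hs
    · refine ⟨?_, ?_⟩
      · rw [lo_L, act_L_eq]; exact (lex_false_true _ _).le
      · rw [← hi_L_true]; exact hi_mono .L h3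
    · exact ⟨(lex_false_true _ _).le, lex_consB_le.2 (act_mono _ h2)⟩
    · exact ⟨lex_consB_le.2 (act_mono _ h1), (lex_false_true _ _).le⟩
    · exact ⟨(act_mono .R h1).trans (lex_le_consB_true _), lex_consB_le.2 (act_mono _ h2)⟩

/-! ### Desubstitution -/

theorem exists_act_eq (g : Gen) {P : Set (ℕ → Bool)}
    (hP : ∀ x ∈ P, ∃ c, ∃ x' ∈ P, x = (g.sub c).foldr consB x') {x : ℕ → Bool} (hx : x ∈ P) :
    ∃ y, x = act g y := by
  choose! c next hnext hc using hP
  have key : ∀ n, ∀ x ∈ P, x n = act g (fun k => c (next^[k] x)) n := by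
    intro n
    induction n using Nat.strong_induction_on with
    | _ n ih =>
      intro x hx
      have e : (fun k => c (next^[k] x)) = consB (c x) (fun k => c (next^[k] (next x))) := by
        funext k; cases k <;> rfl
      have := List.length_pos_of_ne_nil (g.sub_ne_nil (c x))
      rw [e, act_consB, congrFun (hc x hx) n, foldr_consB_apply, foldr_consB_apply]
      split_ifs with h
      · rfl
      · exact ih _ (by omega) _ (hnext x hx)
  exact ⟨_, funext fun n => key n x hx⟩

section Desubst

variable {b a x : ℕ → Bool}

theorem StrictBetween.sh (h : StrictBetween b a x) (k : ℕ) : StrictBetween b a (sh k x) :=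
  fun j => by rw [sh_sh]; exact h (j + k)

theorem strictBetween_desubst_L (ha : a 0 = true)
    (hx : StrictBetween (lo .L b) (hi .L a) x) :
    ∃ k y, sh k x = act .L y ∧ StrictBetween b a y := by
  have ha' := consB_sh_one a
  rw [ha] at ha'
  have h11 : ∀ k, x k = true → x (k + 1) = false := by
    intro k hk
    by_contra hc
    have := (hx k).2
    rw [sh_eq_consB k x, sh_eq_consB (k + 1) x, hk,
      (by simpa using hc : x (k + 1) = true), ← ha', hi_L_true,
      lex_consB_lt, act_L_eq] at this
    exact this.not_gt (lex_false_true _ _)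
  obtain ⟨k, hk⟩ : ∃ k, x k = false := by
    by_contra hc
    push Not at hc
    exact hc 1 (h11 0 (by simpa using hc 0))
  obtain ⟨y, hy⟩ : ∃ y, sh k x = act .L y := by
    refine exists_act_eq .L (P := {z | z 0 = false ∧ ∀ j, z j = true → z (j + 1) = false}) ?_
      ⟨by simpa [sh_apply] using hk, fun j hj => ?_⟩
    · rintro z ⟨h0, hz⟩
      cases h1 : z 1 with
      | false =>
        refine ⟨false, sh 1 z, ⟨h1, fun j hj => hz (j + 1) hj⟩, ?_⟩
        rw [← consB_sh_one z, h0]; rfl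
      | true =>
        refine ⟨true, sh 2 z, ⟨hz 1 h1, fun j hj => hz (j + 2) hj⟩, ?_⟩
        conv_lhs => rw [← consB_sh_one z, h0, sh_eq_consB 1 z, h1]
        rfl
    · have := h11 (j + k) hj
      rw [sh_apply, show j + 1 + k = j + k + 1 by omega]; exact this
  have hx' := hx.sh k
  rw [hy] at hx'
  refine ⟨k, y, hy, fun i => ?_⟩
  obtain ⟨j, hj⟩ := sh_act .L y i
  refine ⟨act_lt_iff.1 (hj ▸ (hx' j).1), ?_⟩
  have hs := sh_eq_consB i y
  cases hc : y i with
  | false => rw [hs, hc, ← ha']; exact lex_false_true _ _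
  | true =>
    have := (hx' (1 + j)).2
    rw [← sh_sh, hj, hs, hc, act_L_true, sh_one_consB, ← ha', hi_L_true, lex_consB_lt,
      act_lt_iff] at this
    rw [hs, hc, ← ha', lex_consB_lt]; exact this

theorem strictBetween_desubst_R (hb : b 0 = false)
    (hx : StrictBetween (lo .R b) (hi .R a) x) :
    ∃ k y, sh k x = act .R y ∧ StrictBetween b a y := by
  have hb' := consB_sh_one b
  rw [hb] at hb'
  have h00 : ∀ k, x k = false → x (k + 1) = true := by
    intro k hk
    by_contra hc
    have := (hx k).1
    rw [sh_eq_consB k x, sh_eq_consB (k + 1) x, hk,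
      (by simpa using hc : x (k + 1) = false), ← hb', lo_R,
      act_R_false, lex_consB_lt] at this
    exact this.not_gt (lex_false_true _ _)
  obtain ⟨y, hy⟩ : ∃ y, x = act .R y := by
    refine exists_act_eq .R (P := {z | ∀ j, z j = false → z (j + 1) = true}) ?_ h00
    intro z hz
    cases h0 : z 0 with
    | true =>
      refine ⟨true, sh 1 z, fun j hj => hz (j + 1) hj, ?_⟩
      rw [← consB_sh_one z, h0]; rfl
    | false =>
      refine ⟨false, sh 2 z, fun j hj => hz (j + 2) hj, ?_⟩
      conv_lhs => rw [← consB_sh_one z, h0, sh_eq_consB 1 z, hz 0 h0]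
      rfl
  obtain ⟨k, hk⟩ := sh_act .R y 1
  refine ⟨k, sh 1 y, by rw [hy, hk], fun i => ?_⟩
  rw [sh_sh]
  constructor
  · obtain ⟨j, hj⟩ := sh_act .R y (i + 1)
    have := (hx j).1
    rw [hy, hj, lo_R, act_lt_iff] at this
    exact this
  · obtain ⟨j, hj⟩ := sh_act .R y i
    rw [sh_eq_consB i y] at hj
    cases hc : y i with
    | true =>
      have := (hx j).2
      rw [hy, hj, hc, act_R_true, hi_R, lex_consB_lt, act_lt_iff] at this
      exact this
    | false =>
      have := (hx (1 + j)).2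
      rw [hy, ← sh_sh, hj, hc, act_R_false, hi_R, sh_one_consB, lex_consB_lt, act_lt_iff] at this
      exact this

theorem act_M_w0bar : act .M w0bar = consB false (consB true (act .M w0bar)) := by
  conv_lhs => rw [← consB_sh_one w0bar]
  exact act_M_false _

theorem act_M_w1bar : act .M w1bar = consB true (consB false (act .M w1bar)) := by
  conv_lhs => rw [← consB_sh_one w1bar]
  exact act_M_true _

/-- The suffixes of an `M`-admissible word starting at a cutting point. -/
def cutSet : Set (ℕ → Bool) :=
  {z | (StrictBetween (lo .M w0bar) (hi .M w1bar) (consB true z) ∧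
      toLex (act .M w0bar) < toLex z) ∨
    (StrictBetween (lo .M w0bar) (hi .M w1bar) (consB false z) ∧
      toLex z < toLex (act .M w1bar))}

theorem lt_false_step {z : ℕ → Bool} (h : toLex (act .M w0bar) < toLex (consB false z)) :
    ∃ w, z = consB true w ∧ toLex (act .M w0bar) < toLex w := by
  rw [act_M_w0bar, lex_consB_lt] at h
  obtain ⟨c, w, rfl⟩ := exists_consB z
  cases c
  · exact absurd h (lex_false_true _ _).not_gt
  · exact ⟨w, rfl, lex_consB_lt.1 h⟩

theorem true_lt_step {z : ℕ → Bool} (h : toLex (consB true z) < toLex (act .M w1bar)) :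
    ∃ w, z = consB false w ∧ toLex w < toLex (act .M w1bar) := by
  rw [act_M_w1bar, lex_consB_lt] at h
  obtain ⟨c, w, rfl⟩ := exists_consB z
  cases c
  · exact ⟨w, rfl, lex_consB_lt.1 h⟩
  · exact absurd h (lex_false_true _ _).not_gt

theorem cutSet_step {z : ℕ → Bool} (hz : z ∈ cutSet) :
    ∃ c, ∃ z' ∈ cutSet, z = (Gen.M.sub c).foldr consB z' := by
  obtain ⟨c, v, rfl⟩ := exists_consB z
  rcases hz with ⟨hz, h⟩ | ⟨hz, h⟩ <;> cases c
  · obtain ⟨w, rfl, hw⟩ := lt_false_step h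
    exact ⟨false, w, Or.inl ⟨hz.sh 2, hw⟩, rfl⟩
  · obtain ⟨w, rfl, hw⟩ := true_lt_step (lex_consB_lt.1 (hz 0).2)
    exact ⟨true, w, Or.inr ⟨hz.sh 2, hw⟩, rfl⟩
  · obtain ⟨w, rfl, hw⟩ := lt_false_step (lex_consB_lt.1 (hz 0).1)
    exact ⟨false, w, Or.inl ⟨hz.sh 2, hw⟩, rfl⟩
  · obtain ⟨w, rfl, hw⟩ := true_lt_step h
    exact ⟨true, w, Or.inr ⟨hz.sh 2, hw⟩, rfl⟩

theorem exists_sh_eq_act_M (hx : StrictBetween (lo .M w0bar) (hi .M w1bar) x) :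
    ∃ k y, sh k x = act .M y := by
  suffices H : (∃ k, sh k x ∈ cutSet) ∨ ∀ j, x (j + 1) = !x j by
    rcases H with ⟨k, hk⟩ | H
    · exact ⟨k, exists_act_eq .M (fun z hz => cutSet_step hz) hk⟩
    · refine ⟨0, exists_act_eq .M (P := {z | ∀ j, z (j + 1) = !z j}) (fun z hz => ?_) H⟩
      refine ⟨z 0, sh 2 z, fun j => hz (j + 2), ?_⟩
      conv_lhs => rw [← consB_sh_one z, sh_eq_consB 1 z, hz 0]
      cases z 0 <;> rfl
  by_contra! hc
  obtain ⟨hc, j, hj⟩ := hc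
  have h := hx.sh j
  have e := sh_eq_consB j x
  rw [sh_eq_consB (j + 1) x] at e
  have hj' : x (j + 1) = x j := by
    cases h1 : x (j + 1) <;> cases h2 : x j <;> simp_all
  refine hc (3 + j) ?_
  rw [← sh_sh 3 j]
  rw [hj'] at e
  rw [e] at h ⊢
  cases h0 : x j <;> rw [h0] at h
  · obtain ⟨w, hw, hw'⟩ := lt_false_step (lex_consB_lt.1 (h 0).1)
    rw [hw] at h ⊢
    exact Or.inl ⟨h.sh 2, hw'⟩
  · obtain ⟨w, hw, hw'⟩ := true_lt_step (lex_consB_lt.1 (h 0).2)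
    rw [hw] at h ⊢
    exact Or.inr ⟨h.sh 2, hw'⟩

theorem strictBetween_desubst_M (hx : StrictBetween (lo .M b) (hi .M a) x) :
    ∃ k y, sh k x = act .M y ∧ (StrictBetween b a y ∨ y = w0bar ∨ y = w1bar) := by
  obtain ⟨k, y, hy⟩ := exists_sh_eq_act_M (x := x) fun k =>
    ⟨(lo_mono .M (lex_zero_le b)).trans_lt (hx k).1, (hx k).2.trans_le (hi_mono .M (lex_le_one a))⟩
  by_cases h0 : ∃ i, y i = false
  swap
  · push Not at h0
    exact ⟨k, y, hy, Or.inr (Or.inr (funext fun i => by simpa [w1bar] using h0 i))⟩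
  by_cases h1 : ∃ i, y i = true
  swap
  · push Not at h1
    exact ⟨k, y, hy, Or.inr (Or.inl (funext fun i => by simpa [w0bar] using h1 i))⟩
  obtain ⟨i0, h0⟩ := h0
  obtain ⟨i1, h1⟩ := h1
  have hx' := hx.sh k
  rw [hy] at hx'
  have hlow : ∀ i, y i = true → toLex b < toLex (sh (i + 1) y) := by
    intro i hi
    obtain ⟨j, hj⟩ := sh_act .M y i
    have := (hx' (1 + j)).1
    rw [← sh_sh, hj, sh_eq_consB i y, hi, act_M_true, sh_one_consB, lo_M, lex_consB_lt,
      act_lt_iff] at this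
    exact this
  have hup : ∀ i, y i = false → toLex (sh (i + 1) y) < toLex a := by
    intro i hi
    obtain ⟨j, hj⟩ := sh_act .M y i
    have := (hx' (1 + j)).2
    rw [← sh_sh, hj, sh_eq_consB i y, hi, act_M_false, sh_one_consB, hi_M, lex_consB_lt,
      act_lt_iff] at this
    exact this
  have hlow' : ∀ i, toLex b < toLex (sh (i1 + 1 + i) y) := by
    intro i
    induction i with
    | zero => exact hlow _ h1
    | succ i ih =>
      cases hc : y (i1 + 1 + i) with
      | true => exact hlow _ hc
      | false =>
        rw [sh_eq_consB (i1 + 1 + i) y, hc] at ih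
        exact ih.trans_le (lex_consB_false_le _)
  have hup' : ∀ i, toLex (sh (i0 + 1 + i) y) < toLex a := by
    intro i
    induction i with
    | zero => exact hup _ h0
    | succ i ih =>
      cases hc : y (i0 + 1 + i) with
      | false => exact hup _ hc
      | true =>
        rw [sh_eq_consB (i0 + 1 + i) y, hc] at ih
        exact (lex_le_consB_true _).trans_lt ih
  obtain ⟨j, hj⟩ := sh_act .M y (i0 + i1 + 1)
  refine ⟨j + k, _, by rw [← sh_sh, hy, hj], Or.inl fun i => ?_⟩
  rw [sh_sh]
  constructor
  · convert hlow' (i + i0) using 3; omega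
  · convert hup' (i + i1) using 3; omega

theorem countable_strictBetween (g : Gen) (hb : b 0 = false) (ha : a 0 = true)
    (h : {x | StrictBetween b a x}.Countable) :
    {x | StrictBetween (lo g b) (hi g a) x}.Countable := by
  refine countable_of_suffix (T := act g '' ({x | StrictBetween b a x} ∪ {w0bar, w1bar}))
    ((h.union (Set.toFinite _).countable).image _) fun x hx => ?_
  have : ∃ k y, sh k x = act g y ∧ (StrictBetween b a y ∨ y = w0bar ∨ y = w1bar) := by
    cases g
    · obtain ⟨k, y, h1, h2⟩ := strictBetween_desubst_L ha hx
      exact ⟨k, y, h1, Or.inl h2⟩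
    · exact strictBetween_desubst_M hx
    · obtain ⟨k, y, h1, h2⟩ := strictBetween_desubst_R hb hx
      exact ⟨k, y, h1, Or.inl h2⟩
  obtain ⟨k, y, h1, h2⟩ := this
  exact ⟨k, y, h2, h1.symm⟩

end Desubst

/-! ### Lists of generators -/

/-- The action of a list of generators on infinite words. -/
noncomputable def acts (l : List Gen) (u : ℕ → Bool) : ℕ → Bool := l.foldr act u
/-- The lower endpoint induced by a list of generators. -/
noncomputable def los (l : List Gen) (u : ℕ → Bool) : ℕ → Bool := l.foldr lo u
/-- The upper endpoint induced by a list of generators. -/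
noncomputable def his (l : List Gen) (u : ℕ → Bool) : ℕ → Bool := l.foldr hi u

@[simp] theorem los_cons (g : Gen) (l : List Gen) (u : ℕ → Bool) :
    los (g :: l) u = lo g (los l u) := rfl
@[simp] theorem his_cons (g : Gen) (l : List Gen) (u : ℕ → Bool) :
    his (g :: l) u = hi g (his l u) := rfl

theorem acts_append (l l' : List Gen) (u : ℕ → Bool) : acts (l ++ l') u = acts l (acts l' u) :=
  List.foldr_append
theorem los_append (l l' : List Gen) (u : ℕ → Bool) : los (l ++ l') u = los l (los l' u) :=
  List.foldr_append
theorem his_append (l l' : List Gen) (u : ℕ → Bool) : his (l ++ l') u = his l (his l' u) :=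
  List.foldr_append

theorem acts_injective (l : List Gen) : Function.Injective (acts l) := by
  induction l with
  | nil => exact Function.injective_id
  | cons g l ih => exact (act_injective g).comp ih

theorem acts_between (l : List Gen) {b a u : ℕ → Bool} (h : Between b a u) :
    Between (los l b) (his l a) (acts l u) := by
  induction l with
  | nil => exact h
  | cons g l ih => exact act_between g ih

theorem lo_strictMono (g : Gen) {u v : ℕ → Bool} (h : toLex u < toLex v) :
    toLex (lo g u) < toLex (lo g v) := by
  cases g
  · exact act_strictMono _ h
  · rw [lo_M, lo_M, lex_consB_lt]; exact act_strictMono _ h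
  · exact act_strictMono _ h

theorem los_pos (l : List Gen) {u : ℕ → Bool} (h : toLex w0bar < toLex u) :
    toLex w0bar < toLex (los l u) := by
  induction l with
  | nil => exact h
  | cons g l ih => exact (lex_zero_le _).trans_lt (lo_strictMono g ih)

theorem los_head (l : List Gen) {b : ℕ → Bool} (h : b 0 = false) : los l b 0 = false := by
  induction l with
  | nil => exact h
  | cons g l ih => exact lo_head g ih

theorem his_head (l : List Gen) {a : ℕ → Bool} (h : a 0 = true) : his l a 0 = true := by
  induction l with
  | nil => exact h
  | cons g l ih => exact hi_head g ih

theorem los_agree (l : List Gen) {N : ℕ} {u v : ℕ → Bool} (h : agree N u v) :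
    agree N (los l u) (los l v) := by
  induction l with
  | nil => exact h
  | cons g l ih => exact lo_agree g ih

theorem his_agree (l : List Gen) {N : ℕ} {u v : ℕ → Bool} (h : agree N u v) :
    agree N (his l u) (his l v) := by
  induction l with
  | nil => exact h
  | cons g l ih => exact hi_agree g ih

theorem los_agree_length (l : List Gen) {u v : ℕ → Bool} (hu : u 0 = false) (hv : v 0 = false) :
    agree l.length (los l u) (los l v) := by
  induction l with
  | nil => exact fun i hi => absurd hi (by simp)
  | cons g l ih => exact lo_agree_succ g (los_head l hu) (los_head l hv) ih

theorem his_agree_length (l : List Gen) {u v : ℕ → Bool} (hu : u 0 = true) (hv : v 0 = true) :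
    agree l.length (his l u) (his l v) := by
  induction l with
  | nil => exact fun i hi => absurd hi (by simp)
  | cons g l ih => exact hi_agree_succ g (his_head l hu) (his_head l hv) ih

theorem countable_strictBetween_list (l : List Gen) {b a : ℕ → Bool} (hb : b 0 = false)
    (ha : a 0 = true) (h : {x | StrictBetween b a x}.Countable) :
    {x | StrictBetween (los l b) (his l a) x}.Countable := by
  induction l with
  | nil => exact h
  | cons g l ih => exact countable_strictBetween g (los_head l hb) (his_head l ha) ih

/-! ### The special words -/

theorem w0bar_eq : w0bar = consB false w0bar := (consB_sh_one w0bar).symm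
theorem w1bar_eq : w1bar = consB true w1bar := (consB_sh_one w1bar).symm
theorem w10bar_eq : w10bar = consB true w0bar := by
  funext n; cases n <;> simp [w10bar, w0bar]
theorem w01bar_eq : w01bar = consB false w1bar := by
  funext n; cases n <;> simp [w01bar, w1bar]
theorem w010bar_eq : w010bar = consB false w10bar := by
  funext n; cases n <;> simp [w010bar, w10bar]
theorem w101bar_eq : w101bar = consB true w01bar := by
  funext n; cases n <;> simp [w101bar, w01bar]

theorem eq_of_fixed_one {c : Bool} {x y : ℕ → Bool} (hx : x = consB c x) (hy : y = consB c y) :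
    x = y := by
  refine eq_of_agree fun N => ?_
  induction N with
  | zero => exact fun i hi => absurd hi (by omega)
  | succ N ih => rw [hx, hy]; exact ih.consB c

theorem eq_of_fixed_two {c d : Bool} {x y : ℕ → Bool} (hx : x = consB c (consB d x))
    (hy : y = consB c (consB d y)) : x = y := by
  refine eq_of_agree fun N => ?_
  induction N with
  | zero => exact fun i hi => absurd hi (by omega)
  | succ N ih => rw [hx, hy]; exact ((ih.consB d).consB c).mono (by omega)

theorem act_L_w0bar : act .L w0bar = w0bar := by
  refine eq_of_fixed_one (c := false) ?_ w0bar_eq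
  conv_lhs => rw [w0bar_eq]
  exact act_L_false _

theorem act_R_w1bar : act .R w1bar = w1bar := by
  refine eq_of_fixed_one (c := true) ?_ w1bar_eq
  conv_lhs => rw [w1bar_eq]
  exact act_R_true _

theorem act_L_w1bar : act .L w1bar = act .M w0bar := by
  refine eq_of_fixed_two (c := false) (d := true) ?_ act_M_w0bar
  conv_lhs => rw [w1bar_eq]
  exact act_L_true _

theorem act_R_w0bar : act .R w0bar = consB false (act .M w1bar) := by
  refine eq_of_fixed_two (c := false) (d := true) ?_ ?_
  · conv_lhs => rw [w0bar_eq]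
    exact act_R_false _
  · conv_lhs => rw [act_M_w1bar]

theorem los_R_w01bar (N : ℕ) : los (List.replicate N .R) w01bar = w01bar := by
  induction N with
  | zero => rfl
  | succ N ih =>
    rw [List.replicate_succ, los_cons, ih, lo_R, w01bar_eq, act_R_false, act_R_w1bar, ← w1bar_eq]

theorem his_R_w1bar (N : ℕ) : his (List.replicate N .R) w1bar = w1bar := by
  induction N with
  | zero => rfl
  | succ N ih => rw [List.replicate_succ, his_cons, ih, hi_R, act_R_w1bar, ← w1bar_eq]

theorem los_L_w0bar (N : ℕ) : los (List.replicate N .L) w0bar = w0bar := by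
  induction N with
  | zero => rfl
  | succ N ih => rw [List.replicate_succ, los_cons, ih, lo_L, act_L_w0bar]

theorem his_L_w10bar (N : ℕ) : his (List.replicate N .L) w10bar = w10bar := by
  induction N with
  | zero => rfl
  | succ N ih => rw [List.replicate_succ, his_cons, ih, w10bar_eq, hi_L_true, act_L_w0bar]

theorem los_R_agree (N : ℕ) : agree N (los (List.replicate N .R) w0bar) w01bar := by
  have := los_agree_length (List.replicate N .R) (u := w0bar) (v := w01bar) rfl rfl
  rwa [List.length_replicate, los_R_w01bar] at this

theorem his_L_agree (N : ℕ) : agree N (his (List.replicate N .L) w1bar) w10bar := by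
  have := his_agree_length (List.replicate N .L) (u := w1bar) (v := w10bar) rfl rfl
  rwa [List.length_replicate, his_L_w10bar] at this

theorem lo_L_w01bar : lo .L w01bar = lo .M w0bar := by
  rw [w01bar_eq, lo_L, act_L_false, act_L_w1bar, lo_M]

theorem hi_L_w1bar : hi .L w1bar = hi .M w0bar := by
  rw [hi_L, act_L_w1bar, act_M_w0bar, sh_one_consB, hi_M]

theorem lo_R_w0bar : lo .R w0bar = lo .M w1bar := by rw [lo_R, act_R_w0bar, lo_M]

theorem hi_R_w10bar : hi .R w10bar = hi .M w1bar := by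
  conv_rhs => rw [hi_M, act_M_w1bar]
  rw [w10bar_eq, hi_R, act_R_true, act_R_w0bar]

theorem los_LR_agree (l : List Gen) (N : ℕ) :
    agree N (los (l ++ .L :: List.replicate N .R) w0bar) (los l (lo .M w0bar)) := by
  rw [los_append, los_cons, ← lo_L_w01bar]
  exact los_agree l (lo_agree _ (los_R_agree N))

theorem his_LR (l : List Gen) (N : ℕ) :
    his (l ++ .L :: List.replicate N .R) w1bar = his l (hi .M w0bar) := by
  rw [his_append, his_cons, his_R_w1bar, hi_L_w1bar]

theorem los_RL (l : List Gen) (N : ℕ) :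
    los (l ++ .R :: List.replicate N .L) w0bar = los l (lo .M w1bar) := by
  rw [los_append, los_cons, los_L_w0bar, lo_R_w0bar]

theorem his_RL_agree (l : List Gen) (N : ℕ) :
    agree N (his (l ++ .R :: List.replicate N .L) w1bar) (his l (hi .M w1bar)) := by
  rw [his_append, his_cons, ← hi_R_w10bar]
  exact his_agree l (hi_agree _ (his_L_agree N))

theorem pos_of_apply {u : ℕ → Bool} {k : ℕ} (h : u k = true) : toLex w0bar < toLex u := by
  refine (lex_zero_le u).lt_of_ne fun hc => ?_
  have := congrFun (toLex_inj.1 hc) k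
  rw [h] at this
  exact absurd this (by simp [w0bar])

theorem act_M_pos (u : ℕ → Bool) : toLex w0bar < toLex (act .M u) := by
  refine lt_of_lt_of_le ?_ (act_mono .M (lex_zero_le u))
  rw [act_M_w0bar]
  exact pos_of_apply (k := 1) rfl

theorem act_R_pos (u : ℕ → Bool) : toLex w0bar < toLex (act .R u) := by
  refine lt_of_lt_of_le ?_ (act_mono .R (lex_zero_le u))
  rw [act_R_w0bar, act_M_w1bar]
  exact pos_of_apply (k := 1) rfl

theorem lo_M_pos (u : ℕ → Bool) : toLex w0bar < toLex (lo .M u) := by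
  rw [lo_M, w0bar_eq, lex_consB_lt]
  exact act_M_pos u

/-! ### Words without admissible sequences strictly between -/

theorem strictBetween_w10bar : {x | StrictBetween w0bar w10bar x} = ∅ := by
  refine Set.eq_empty_of_forall_notMem fun x hx => ?_
  have : ∀ k, x k = false := by
    intro k
    by_contra hc
    have := (hx k).2
    rw [sh_eq_consB, (by simpa using hc : x k = true), w10bar_eq, lex_consB_lt] at this
    exact (lex_zero_le _).not_gt this
  exact (hx 0).1.ne (toLex_inj.2 (funext fun k => (this k).symm))

theorem strictBetween_w01bar : {x | StrictBetween w01bar w1bar x} = ∅ := by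
  refine Set.eq_empty_of_forall_notMem fun x hx => ?_
  have : ∀ k, x k = true := by
    intro k
    by_contra hc
    have := (hx k).1
    rw [sh_eq_consB, (by simpa using hc : x k = false), w01bar_eq, lex_consB_lt] at this
    exact (lex_le_one _).not_gt this
  exact (hx 0).2.ne (toLex_inj.2 (funext fun k => this k))

theorem countable_his_w10bar (l : List Gen) :
    {x | StrictBetween (los l w0bar) (his l w10bar) x}.Countable :=
  countable_strictBetween_list l rfl rfl (by rw [strictBetween_w10bar]; exact Set.countable_empty)

theorem countable_los_w01bar (l : List Gen) :
    {x | StrictBetween (los l w01bar) (his l w1bar) x}.Countable :=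
  countable_strictBetween_list l rfl rfl (by rw [strictBetween_w01bar]; exact Set.countable_empty)

theorem not_countable_words : ¬ (Set.univ : Set (ℕ → Bool)).Countable := by
  intro h
  have := Set.countable_univ_iff.1 h
  obtain ⟨f, hf⟩ := exists_surjective_nat (ℕ → Bool)
  obtain ⟨n, hn⟩ := hf fun n => !f n n
  have := congrFun hn n
  simp at this

theorem binU_not_countable {β m : ℝ} (hβ : 2 < β) (hm : 1 < m) (hm2 : m ≤ 2) (l : List Gen)
    (hF : F β (his l w1bar) < m) (hG : m < G β (los l w0bar)) : ¬ (binU β m).Countable := by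
  intro h
  have hsub : Set.range (acts l) ⊆ binU β m := by
    rintro x ⟨y, rfl⟩
    exact mem_binU_of_between hβ hm hm2 hF hG
      (acts_between l fun k => ⟨lex_zero_le _, lex_le_one _⟩)
  refine not_countable_words ?_
  have := (h.mono hsub).preimage_of_injOn (f := acts l) (acts_injective l).injOn
  rwa [Set.preimage_range] at this

/-! ### Extremal suffixes of substitutive words -/

theorem good_of_pass {u : ℕ → Bool} (hb : toLex w0bar < toLex (infO u))
    (h : ∀ N, ∃ k, u k = true ∧ agree N (sh (k + 1) u) (infO u)) : Good (infO u) (supO u) := by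
  refine ⟨le_of_approx_right fun N => ?_, fun N => ?_⟩
  · obtain ⟨k, hk, hN⟩ := h N
    refine ⟨sh k u, ?_, sh_le_supO u k⟩
    rw [sh_eq_consB, hk]
    exact (hN.consB _).mono (by omega)
  · by_contra! hc
    refine hb.not_ge ?_
    have : sh N (supO u) = w0bar := funext fun i => by
      simpa [w0bar, sh_apply] using hc (i + N) (by omega)
    rw [← this]
    refine le_of_approx_left fun j => ?_
    obtain ⟨s, ⟨k, rfl⟩, hs⟩ := lexSupSeq_approx (S := orbit u) ⟨u, 0, rfl⟩ (j + N)
    refine ⟨sh (N + k) u, fun i hi => ?_, infO_le_sh _ _⟩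
    have := hs (i + N) (by omega)
    rw [sh_apply, show i + (N + k) = i + N + k by omega]
    exact this

/-- `b` and `a` bound the suffixes of `u`, and occur in `u` after a `1` and a `0` respectively. -/
structure Extremal (u b a : ℕ → Bool) : Prop where
  between : Between b a u
  head : a 0 = true
  exists_lo : ∃ k, u k = true ∧ sh (k + 1) u = b
  exists_hi : ∃ k, u k = false ∧ sh (k + 1) u = a

namespace Extremal

variable {u b a : ℕ → Bool}

theorem act (h : Extremal u b a) (g : Gen) : Extremal (act g u) (lo g b) (hi g a) := by
  refine ⟨act_between g h.between, hi_head g h.head, ?_, ?_⟩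
  · obtain ⟨k, hk, rfl⟩ := h.exists_lo
    exact exists_sh_eq_lo g hk
  · have h0 := h.head
    obtain ⟨k, hk, rfl⟩ := h.exists_hi
    exact exists_sh_eq_hi g hk (by simpa [sh_apply] using h0)

theorem acts (h : Extremal u b a) (l : List Gen) :
    Extremal (acts l u) (los l b) (his l a) := by
  induction l with
  | nil => exact h
  | cons g l ih => exact ih.act g

theorem infO_eq (h : Extremal u b a) : infO u = b := by
  obtain ⟨k, -, hk⟩ := h.exists_lo
  exact _root_.infO_eq (fun k => (h.between k).1) fun N => ⟨k + 1, hk ▸ fun _ _ => rfl⟩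

theorem supO_eq (h : Extremal u b a) : supO u = a := by
  obtain ⟨k, -, hk⟩ := h.exists_hi
  exact _root_.supO_eq (fun k => (h.between k).2) fun N => ⟨k + 1, hk ▸ fun _ _ => rfl⟩

theorem good (h : Extremal u b a) (hb : toLex w0bar < toLex b) : Good b a := by
  have := good_of_pass (u := u) (by rwa [h.infO_eq]) fun N => by
    obtain ⟨k, hk, hb⟩ := h.exists_lo
    exact ⟨k, hk, by rw [h.infO_eq, hb]; exact fun _ _ => rfl⟩
  rwa [h.infO_eq, h.supO_eq] at this

end Extremal

theorem Between.consB {b a u : ℕ → Bool} (h : Between b a u) {c : Bool}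
    (h1 : toLex b ≤ toLex (consB c u)) (h2 : toLex (consB c u) ≤ toLex a) :
    Between b a (consB c u) := by
  intro k
  cases k with
  | zero => exact ⟨h1, h2⟩
  | succ k => exact h k

theorem between_const (c : Bool) : Between (fun _ => c) (fun _ => c) (fun _ => c) :=
  fun _ => ⟨le_rfl, le_rfl⟩

theorem extremal_w10bar : Extremal (act .M w10bar) (lo .M w0bar) (hi .M w0bar) := by
  have e : act .M w10bar = consB true (consB false (act .M w0bar)) := by
    rw [w10bar_eq, act_M_true]
  have hB : Between (lo .M w0bar) (hi .M w0bar) (act .M w0bar) :=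
    act_between .M (between_const false)
  refine ⟨?_, rfl, ?_, ?_⟩
  · rw [e]
    exact (hB.consB (lo_M _ ▸ le_rfl) (lex_false_true _ _).le).consB (lex_false_true _ _).le
      (lex_consB_le.2 (lex_consB_false_le _))
  · rw [e]; exact ⟨0, rfl, rfl⟩
  · rw [e, act_M_w0bar]; exact ⟨2, rfl, rfl⟩

theorem extremal_w01bar : Extremal (act .M w01bar) (lo .M w1bar) (hi .M w1bar) := by
  have e : act .M w01bar = consB false (consB true (act .M w1bar)) := by
    rw [w01bar_eq, act_M_false]
  have hB : Between (lo .M w1bar) (hi .M w1bar) (act .M w1bar) :=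
    act_between .M (between_const true)
  refine ⟨?_, rfl, ?_, ?_⟩
  · rw [e]
    exact (hB.consB (lex_false_true _ _).le (hi_M _ ▸ le_rfl)).consB
      (lex_consB_le.2 (lex_le_consB_true _)) (lex_false_true _ _).le
  · rw [e, act_M_w1bar]; exact ⟨2, rfl, rfl⟩
  · rw [e]; exact ⟨0, rfl, rfl⟩

theorem extremal_w010bar : Extremal (act .M w010bar) (lo .M w0bar) (hi .M w10bar) := by
  have e : act .M w010bar = consB false (consB true (act .M w10bar)) := by
    rw [w010bar_eq, act_M_false]
  refine ⟨act_between .M ?_, rfl, ?_, ?_⟩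
  · have h0 : Between w0bar w10bar w0bar :=
      fun _ => ⟨lex_zero_le _, lex_zero_le _⟩
    have h1 : Between w0bar w10bar w10bar := by
      rw [w10bar_eq] at h0 ⊢
      exact h0.consB (lex_zero_le _) le_rfl
    rw [w010bar_eq]
    refine h1.consB (lex_zero_le _) ?_
    rw [w10bar_eq]
    exact (lex_false_true _ _).le
  · rw [e, w10bar_eq, act_M_true]; exact ⟨2, rfl, rfl⟩
  · rw [e]; exact ⟨0, rfl, rfl⟩

theorem extremal_w101bar : Extremal (act .M w101bar) (lo .M w01bar) (hi .M w1bar) := by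
  have e : act .M w101bar = consB true (consB false (act .M w01bar)) := by
    rw [w101bar_eq, act_M_true]
  refine ⟨act_between .M ?_, rfl, ?_, ?_⟩
  · have h0 : Between w01bar w1bar w1bar :=
      fun _ => ⟨lex_le_one _, lex_le_one _⟩
    have h1 : Between w01bar w1bar w01bar := by
      rw [w01bar_eq] at h0 ⊢
      exact h0.consB le_rfl (lex_le_one _)
    rw [w101bar_eq]
    refine h1.consB ?_ (lex_le_one _)
    rw [w01bar_eq]
    exact (lex_false_true _ _).le
  · rw [e]; exact ⟨0, rfl, rfl⟩
  · rw [e, w01bar_eq, act_M_false]; exact ⟨2, rfl, rfl⟩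

/-! ### Approximation of the critical values -/

section Near

variable {β m : ℝ} {u : ℕ → Bool}

theorem F_lt_of_agree (hβ : 1 < β) (h : F β u < m) : ∃ N, ∀ v, agree N v u → F β v < m := by
  obtain ⟨N, hN⟩ := F_near hβ (sub_pos.2 h)
  exact ⟨N, fun v hv => by linarith [(abs_lt.1 (hN v u hv)).2]⟩

theorem lt_F_of_agree (hβ : 1 < β) (h : m < F β u) : ∃ N, ∀ v, agree N v u → m < F β v := by
  obtain ⟨N, hN⟩ := F_near hβ (sub_pos.2 h)
  exact ⟨N, fun v hv => by linarith [(abs_lt.1 (hN v u hv)).1]⟩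

theorem G_lt_of_agree (hβ : 1 < β) (h : G β u < m) : ∃ N, ∀ v, agree N v u → G β v < m := by
  obtain ⟨N, hN⟩ := G_near hβ (sub_pos.2 h)
  exact ⟨N, fun v hv => by linarith [(abs_lt.1 (hN v u hv)).2]⟩

theorem lt_G_of_agree (hβ : 1 < β) (h : m < G β u) : ∃ N, ∀ v, agree N v u → m < G β v := by
  obtain ⟨N, hN⟩ := G_near hβ (sub_pos.2 h)
  exact ⟨N, fun v hv => by linarith [(abs_lt.1 (hN v u hv)).1]⟩

end Near

/-! ### The critical base on the intervals -/

section Intervals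

variable {m : ℝ}

theorem Lval_eq_gv (l : List Gen) (h1 : 1 < m) (h2 : m ≤ 2)
    (hm : muv (los l (lo .M w0bar)) (his l (hi .M w0bar)) ≤ m)
    (hm' : m ≤ muv (los l (lo .M w0bar)) (his l (hi .M w10bar))) :
    Lval m = gv (los l (lo .M w0bar)) m := by
  have hpos : toLex w0bar < toLex (los l (lo .M w0bar)) := los_pos l (lo_M_pos _)
  have hG := (extremal_w10bar.acts l).good hpos
  have hG' := (extremal_w010bar.acts l).good hpos
  obtain ⟨hg1, -, hg2⟩ := gv_spec (los l (lo .M w0bar)) h1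
  refine Lval_eq hg1 (fun β hβ => ?_) fun β hβ1 hβ => ?_
  · have hf := (hG.fv_le_gv h2 hm).trans_lt hβ
    have hβ2 := hG.two_lt h1 h2 hf hβ
    obtain ⟨N, hN⟩ := lt_G_of_agree (by linarith) (gv_lt h1 hβ)
    refine binU_not_countable hβ2 h1 h2 (l ++ .L :: List.replicate N .R) ?_
      (hN _ (los_LR_agree l N))
    rw [his_LR]
    exact fv_lt hG.ones h1 h2 hf
  · rcases le_or_gt β 2 with hβ2 | hβ2
    · exact binU_countable_of_le_two hβ1 hβ2 h1 h2
    · refine binU_countable hβ2 h1 h2 (hβ.le.trans hg2) (his_head l rfl)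
        (lt_fv hG'.ones h1 h2 hβ1 (hβ.trans_le (hG'.gv_le_fv h1 hm'))).le
        (lt_gv h1 hβ1 hβ).le ?_
      have := countable_his_w10bar (l ++ [.M])
      rwa [los_append, his_append] at this

theorem Lval_eq_fv (l : List Gen) (h1 : 1 < m) (h2 : m ≤ 2)
    (hm : muv (los l (lo .M w01bar)) (his l (hi .M w1bar)) ≤ m)
    (hm' : m ≤ muv (los l (lo .M w1bar)) (his l (hi .M w1bar))) :
    Lval m = fv (his l (hi .M w1bar)) m := by
  have hG := (extremal_w01bar.acts l).good (los_pos l (lo_M_pos _))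
  have hG' := (extremal_w101bar.acts l).good (los_pos l (lo_M_pos _))
  obtain ⟨hf1, -⟩ := fv_spec hG.ones h1 h2
  obtain ⟨-, -, hg2⟩ := gv_spec (los l (lo .M w01bar)) h1
  have hfg := hG'.fv_le_gv h2 hm
  refine Lval_eq hf1 (fun β hβ => ?_) fun β hβ1 hβ => ?_
  · have hg := (hG.gv_le_fv h1 hm').trans_lt hβ
    have hβ2 := hG.two_lt h1 h2 hβ hg
    obtain ⟨N, hN⟩ := F_lt_of_agree (by linarith) (fv_lt hG.ones h1 h2 hβ)
    refine binU_not_countable hβ2 h1 h2 (l ++ .R :: List.replicate N .L)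
      (hN _ (his_RL_agree l N)) ?_
    rw [los_RL]
    exact gv_lt h1 hg
  · rcases le_or_gt β 2 with hβ2 | hβ2
    · exact binU_countable_of_le_two hβ1 hβ2 h1 h2
    · refine binU_countable hβ2 h1 h2 ((hβ.le.trans hfg).trans hg2) (his_head l rfl)
        (lt_fv hG.ones h1 h2 hβ1 hβ).le (lt_gv h1 hβ1 (hβ.trans_le hfg)).le ?_
      have := countable_los_w01bar (l ++ [.M])
      rwa [los_append, his_append] at this

theorem infO_w01bar : infO w01bar = w01bar := by
  refine infO_eq (fun k => ?_) fun N => ⟨0, fun _ _ => rfl⟩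
  cases k with
  | zero => exact le_rfl
  | succ k =>
    have : sh (k + 1) w01bar = w1bar := funext fun i => by simp [sh_apply, w01bar, w1bar]
    rw [this]
    exact lex_le_one _

theorem supO_w01bar : supO w01bar = w1bar := by
  refine supO_eq (fun k => lex_le_one _) fun N => ⟨1, fun i _ => ?_⟩
  simp [sh_apply, w01bar, w1bar]

theorem good_w01bar : Good w01bar w1bar :=
  ⟨lex_le_one _, fun N => ⟨N, le_rfl, rfl⟩⟩

theorem Lval_eq_gv_w01bar (h1 : 1 < m) (h2 : m ≤ 2) (hm : muv w01bar w1bar ≤ m) :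
    Lval m = gv w01bar m := by
  obtain ⟨hg1, -, hg2⟩ := gv_spec w01bar h1
  refine Lval_eq hg1 (fun β hβ => ?_) fun β hβ1 hβ => ?_
  · have hf := (good_w01bar.fv_le_gv h2 hm).trans_lt hβ
    have hβ2 := good_w01bar.two_lt h1 h2 hf hβ
    obtain ⟨N, hN⟩ := lt_G_of_agree (by linarith) (gv_lt h1 hβ)
    refine binU_not_countable hβ2 h1 h2 (List.replicate N .R) ?_ (hN _ (los_R_agree N))
    rw [his_R_w1bar]
    exact fv_lt good_w01bar.ones h1 h2 hf
  · rcases le_or_gt β 2 with hβ2 | hβ2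
    · exact binU_countable_of_le_two hβ1 hβ2 h1 h2
    · refine binU_countable_of_suffix (Set.countable_singleton w1bar) fun x hx k hk =>
        ⟨k + 1, ?_⟩
      have hlo := lt_suffix_of_lt_after_one (b := w01bar) hk fun i hi => not_le.1 fun hle => by
        have := (between_of_mem_binU hβ2 h1 h2 (hβ.le.trans hg2) hx hi).2
        linarith [G_lex_le hβ2.le hle, lt_gv h1 hβ1 hβ]
      refine funext fun j => ?_
      by_contra hc
      have h := hlo j
      rw [sh_eq_consB j, (by simpa [w1bar] using hc : sh (k + 1) x j = false), w01bar_eq,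
        lex_consB_lt] at h
      exact (lex_le_one _).not_gt h

end Intervals

/-! ### Limit words -/

/-- The word `v` contains the factor `cd`. -/
def HasFactor (c d : Bool) (v : ℕ → Bool) : Prop := ∃ k, v k = c ∧ v (k + 1) = d

theorem HasFactor.of_sh {c d : Bool} {v w : ℕ → Bool} {k : ℕ}
    (h : sh k v = consB c (consB d w)) : HasFactor c d v := by
  refine ⟨k, ?_, ?_⟩
  · simpa [sh_apply] using congrFun h 0
  · simpa [sh_apply, Nat.add_comm] using congrFun h 1

theorem HasFactor.of_sh_succ {c d e : Bool} {v w : ℕ → Bool} {k : ℕ}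
    (h : sh k v = consB e (consB c (consB d w))) : HasFactor c d v :=
  HasFactor.of_sh (k := 1 + k) (w := w) (by rw [← sh_sh, h]; rfl)

theorem exists_eq_true_of_ne {v : ℕ → Bool} (h : v ≠ w0bar) : ∃ k, v k = true := by
  by_contra! hc
  exact h (funext fun k => by simpa [w0bar] using hc k)

theorem exists_eq_false_of_ne {v : ℕ → Bool} (h : v ≠ w1bar) : ∃ k, v k = false := by
  by_contra! hc
  exact h (funext fun k => by simpa [w1bar] using hc k)

section Limit

variable {γ : ℕ → Gen} {v : ℕ → ℕ → Bool}

theorem desubst_ne_w0bar (hL : ¬ ∃ k, ∀ n, k ≤ n → γ n = .L)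
    (hv : ∀ n, v n = act (γ n) (v (n + 1))) (n : ℕ) : v n ≠ w0bar := by
  intro h
  have step : ∀ j, v j = w0bar → γ j = .L ∧ v (j + 1) = w0bar := by
    intro j hj
    have := hv j
    rw [hj] at this
    cases hg : γ j
    · rw [hg] at this
      exact ⟨rfl, act_injective .L (this.symm.trans act_L_w0bar.symm)⟩
    · rw [hg] at this
      exact absurd (congrArg toLex this) (act_M_pos _).ne
    · rw [hg] at this
      exact absurd (congrArg toLex this) (act_R_pos _).ne
  have all : ∀ j, n ≤ j → v j = w0bar := fun j hj => by
    induction j, hj using Nat.le_induction with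
    | base => exact h
    | succ j _ ih => exact (step j ih).2
  exact hL ⟨n, fun j hj => (step j (all j hj)).1⟩

theorem desubst_ne_w1bar (hR : ¬ ∃ k, ∀ n, k ≤ n → γ n = .R)
    (hv : ∀ n, v n = act (γ n) (v (n + 1))) (n : ℕ) : v n ≠ w1bar := by
  intro h
  have step : ∀ j, v j = w1bar → γ j = .R ∧ v (j + 1) = w1bar := by
    intro j hj
    have := hv j
    rw [hj] at this
    cases hg : γ j
    · rw [hg, act_L_eq] at this
      exact absurd (congrFun this 0) (by simp [w1bar])
    · rw [hg] at this
      obtain ⟨c, w, hw⟩ := exists_consB (v (j + 1))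
      rw [hw] at this
      cases c
      · exact absurd (congrFun this 0) (by simp [w1bar])
      · exact absurd (congrFun this 1) (by simp [w1bar])
    · rw [hg] at this
      exact ⟨rfl, act_injective .R (this.symm.trans act_R_w1bar.symm)⟩
  have all : ∀ j, n ≤ j → v j = w1bar := fun j hj => by
    induction j, hj using Nat.le_induction with
    | base => exact h
    | succ j _ ih => exact (step j ih).2
  exact hR ⟨n, fun j hj => (step j (all j hj)).1⟩

theorem desubst_hasFactor_false_true (hL : ¬ ∃ k, ∀ n, k ≤ n → γ n = .L)
    (hR : ¬ ∃ k, ∀ n, k ≤ n → γ n = .R) (hv : ∀ n, v n = act (γ n) (v (n + 1))) (n : ℕ) :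
    HasFactor false true (v n) := by
  rw [hv n]
  obtain ⟨i, hi⟩ := exists_eq_true_of_ne (desubst_ne_w0bar hL hv (n + 1))
  obtain ⟨k, hk⟩ := exists_eq_false_of_ne (desubst_ne_w1bar hR hv (n + 1))
  obtain ⟨i', hi'⟩ := sh_act (γ n) (v (n + 1)) i
  obtain ⟨k', hk'⟩ := sh_act (γ n) (v (n + 1)) k
  rw [sh_eq_consB i, hi] at hi'
  rw [sh_eq_consB k, hk] at hk'
  cases hg : γ n <;> rw [hg] at hi' hk'
  · rw [act_L_true] at hi'; exact .of_sh hi'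
  · rw [act_M_false] at hk'; exact .of_sh hk'
  · rw [act_R_false] at hk'; exact .of_sh hk'

theorem desubst_hasFactor_true_false (hL : ¬ ∃ k, ∀ n, k ≤ n → γ n = .L)
    (hR : ¬ ∃ k, ∀ n, k ≤ n → γ n = .R) (hv : ∀ n, v n = act (γ n) (v (n + 1))) (n : ℕ) :
    HasFactor true false (v n) := by
  by_contra h
  have step : ∀ j, ¬ HasFactor true false (v j) →
      γ j = .R ∧ ¬ HasFactor true false (v (j + 1)) := by
    intro j hj
    rw [hv j] at hj
    obtain ⟨i, hi⟩ := exists_eq_true_of_ne (desubst_ne_w0bar hL hv (j + 1))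
    obtain ⟨i', hi'⟩ := sh_act (γ j) (v (j + 1)) i
    rw [sh_eq_consB i, hi] at hi'
    cases hg : γ j <;> rw [hg] at hi' hj
    · rw [act_L_true, act_L_eq (sh (i + 1) (v (j + 1)))] at hi'
      exact absurd (.of_sh_succ hi') hj
    · rw [act_M_true] at hi'
      exact absurd (.of_sh hi') hj
    · refine ⟨rfl, fun ⟨k, hk, hk1⟩ => hj ?_⟩
      obtain ⟨k', hk'⟩ := sh_act .R (v (j + 1)) k
      rw [sh_eq_consB k, sh_eq_consB (k + 1), hk, hk1, act_R_true, act_R_false] at hk'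
      exact .of_sh hk'
  have all : ∀ j, n ≤ j → ¬ HasFactor true false (v j) := fun j hj => by
    induction j, hj using Nat.le_induction with
    | base => exact h
    | succ j _ ih => exact (step j ih).2
  exact hR ⟨n, fun j hj => (step j (all j hj)).1⟩

end Limit

theorem exists_sh_eq_los (l : List Gen) {u : ℕ → Bool} {k : ℕ} (h : u k = true) :
    ∃ j, acts l u j = true ∧ sh (j + 1) (acts l u) = los l (sh (k + 1) u) := by
  induction l with
  | nil => exact ⟨k, h, rfl⟩
  | cons g l ih =>
    obtain ⟨j, hj, e⟩ := ih
    rw [los_cons, ← e]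
    exact exists_sh_eq_lo g hj

theorem exists_sh_eq_his (l : List Gen) {u : ℕ → Bool} {k : ℕ} (h : u k = false)
    (h1 : u (k + 1) = true) :
    ∃ j, acts l u j = false ∧ sh (j + 1) (acts l u) = his l (sh (k + 1) u) := by
  induction l with
  | nil => exact ⟨k, h, rfl⟩
  | cons g l ih =>
    obtain ⟨j, hj, e⟩ := ih
    have h0 : his l (sh (k + 1) u) 0 = true := his_head l (by simpa [sh_apply] using h1)
    rw [← e, sh_apply, Nat.zero_add] at h0
    rw [his_cons, ← e]
    exact exists_sh_eq_hi g hj h0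

theorem los_le_infO (l : List Gen) (v : ℕ → Bool) :
    toLex (los l w0bar) ≤ toLex (infO (acts l v)) := by
  have hB : Between (los l w0bar) (his l w1bar) (acts l v) :=
    acts_between l fun k => ⟨lex_zero_le _, lex_le_one _⟩
  refine le_of_approx_left fun N => ?_
  obtain ⟨s, ⟨k, rfl⟩, hs⟩ := lexInfSeq_approx (S := orbit (acts l v)) ⟨_, 0, rfl⟩ N
  exact ⟨_, hs, (hB k).1⟩

theorem supO_le_his (l : List Gen) (v : ℕ → Bool) :
    toLex (supO (acts l v)) ≤ toLex (his l w1bar) := by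
  have hB : Between (los l w0bar) (his l w1bar) (acts l v) :=
    acts_between l fun k => ⟨lex_zero_le _, lex_le_one _⟩
  refine le_of_approx_right fun N => ?_
  obtain ⟨s, ⟨k, rfl⟩, hs⟩ := lexSupSeq_approx (S := orbit (acts l v)) ⟨_, 0, rfl⟩ N
  exact ⟨_, hs, (hB k).2⟩

theorem los_agree_infO (l : List Gen) {v z : ℕ → Bool} (h : HasFactor true false v)
    (hz : z 0 = false) : agree l.length (los l z) (infO (acts l v)) := by
  obtain ⟨k, hk, hk1⟩ := h
  obtain ⟨j, -, hj⟩ := exists_sh_eq_los l hk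
  have h0 : sh (k + 1) v 0 = false := by simpa [sh_apply] using hk1
  refine (los_agree_length l hz rfl).trans (agree_of_between (los_le_infO l v)
    (hj ▸ infO_le_sh _ (j + 1)) (los_agree_length l rfl h0))

theorem his_agree_supO (l : List Gen) {v z : ℕ → Bool} (h : HasFactor false true v)
    (hz : z 0 = true) : agree l.length (his l z) (supO (acts l v)) := by
  obtain ⟨k, hk, hk1⟩ := h
  obtain ⟨j, -, hj⟩ := exists_sh_eq_his l hk hk1
  have h0 : sh (k + 1) v 0 = true := by simpa [sh_apply] using hk1
  refine (his_agree_length l hz h0).trans (agree_of_between (hj ▸ sh_le_supO _ (j + 1))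
    (supO_le_his l v) (his_agree_length l h0 rfl))

theorem exists_gen {τ : Bool → List Bool} (h : τ = Lsub ∨ τ = Msub ∨ τ = Rsub) :
    ∃ g : Gen, τ = g.sub := by
  rcases h with rfl | rfl | rfl
  exacts [⟨.L, rfl⟩, ⟨.M, rfl⟩, ⟨.R, rfl⟩]

theorem exists_desubst {u : ℕ → Bool} (hu : u ∈ Sset) :
    toLex w0bar < toLex (infO u) ∧ ∀ n, ∃ l : List Gen, ∃ v, l.length = n ∧ u = acts l v ∧
      HasFactor true false v ∧ HasFactor false true v := by
  obtain ⟨σ, hσ, ⟨hL, hR⟩, v, rfl, hv⟩ := hu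
  choose γ hγ using fun n => exists_gen (hσ n)
  have hL' : ¬ ∃ k, ∀ n, k ≤ n → γ n = .L :=
    fun ⟨k, hk⟩ => hL ⟨k, fun n hn => by rw [hγ, hk n hn]; rfl⟩
  have hR' : ¬ ∃ k, ∀ n, k ≤ n → γ n = .R :=
    fun ⟨k, hk⟩ => hR ⟨k, fun n hn => by rw [hγ, hk n hn]; rfl⟩
  have hv' : ∀ n, v n = act (γ n) (v (n + 1)) := fun n => by rw [hv n, hγ]; rfl
  have hacts : ∀ n, v 0 = acts ((List.range n).map γ) (v n) := by
    intro n
    induction n with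
    | zero => rfl
    | succ n ih => rw [List.range_succ, List.map_append, acts_append, ih, hv' n]; rfl
  refine ⟨?_, fun n => ⟨_, v n, by simp, hacts n, desubst_hasFactor_true_false hL' hR' hv' n,
    desubst_hasFactor_false_true hL' hR' hv' n⟩⟩
  push Not at hL'
  obtain ⟨n, -, hn⟩ := hL' 0
  rw [hacts (n + 1)]
  refine lt_of_lt_of_le ?_ (los_le_infO _ _)
  rw [List.range_succ, List.map_append, los_append]
  refine los_pos _ ?_
  change toLex w0bar < toLex (lo (γ n) w0bar)
  cases hg : γ n
  · exact absurd hg hn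
  · exact lo_M_pos _
  · exact act_R_pos _

theorem Lval_eq_fv_limit {u : ℕ → Bool} (hu : u ∈ Sset) :
    Lval (muv (infO u) (supO u)) = fv (supO u) (muv (infO u) (supO u)) := by
  obtain ⟨hpos, hl⟩ := exists_desubst hu
  have hG : Good (infO u) (supO u) := by
    refine good_of_pass hpos fun N => ?_
    obtain ⟨l, v, rfl, rfl, h10, -⟩ := hl N
    have h10' := h10
    obtain ⟨k, hk, hk1⟩ := h10
    obtain ⟨j, hj, e⟩ := exists_sh_eq_los l hk
    refine ⟨j, hj, ?_⟩
    rw [e]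
    exact los_agree_infO l h10' (by simpa [sh_apply] using hk1)
  obtain ⟨h1, h2, he⟩ := hG.muv_spec
  generalize muv (infO u) (supO u) = m at *
  obtain ⟨hf1, -⟩ := fv_spec hG.ones h1 h2
  obtain ⟨-, -, hg2⟩ := gv_spec (infO u) h1
  refine Lval_eq hf1 (fun β hβ => ?_) fun β hβ1 hβ => ?_
  · have hβ2 := hG.two_lt h1 h2 hβ (he ▸ hβ)
    obtain ⟨N, hN⟩ := F_lt_of_agree (by linarith) (fv_lt hG.ones h1 h2 hβ)
    obtain ⟨N', hN'⟩ := lt_G_of_agree (by linarith) (gv_lt h1 (he ▸ hβ))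
    obtain ⟨l, v, hlen, rfl, h10, h01⟩ := hl (max N N')
    exact binU_not_countable hβ2 h1 h2 l
      (hN _ ((his_agree_supO l h01 rfl).mono (by omega)))
      (hN' _ ((los_agree_infO l h10 rfl).mono (by omega)))
  · rcases le_or_gt β 2 with hβ2 | hβ2
    · exact binU_countable_of_le_two hβ1 hβ2 h1 h2
    · obtain ⟨N, hN⟩ := lt_F_of_agree hβ1 (lt_fv hG.ones h1 h2 hβ1 hβ)
      obtain ⟨N', hN'⟩ := G_lt_of_agree hβ1 (lt_gv h1 hβ1 (he ▸ hβ))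
      obtain ⟨l, v, hlen, rfl, h10, h01⟩ := hl (max N N')
      exact binU_countable hβ2 h1 h2 (by linarith) (his_head l rfl)
        (hN _ ((his_agree_supO l h01 rfl).mono (by omega))).le
        (hN' _ ((los_agree_infO l h10 rfl).mono (by omega))).le (countable_los_w01bar l)

theorem exists_acts_eq {σ : Bool → List Bool} (hσ : σ ∈ LMRstar) :
    ∃ l : List Gen, ∀ u, substApply (compSub σ Msub) u = acts l (act .M u) := by
  obtain ⟨l, hl, rfl⟩ := hσ
  suffices H : (∀ c, l.foldr compSub idSub c ≠ []) ∧
      ∃ l' : List Gen, ∀ u, substApply (l.foldr compSub idSub) u = acts l' u by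
    obtain ⟨h1, l', h2⟩ := H
    exact ⟨l', fun u =>
      (substApply_compSub (τ := Msub) h1 Gen.M.sub_ne_nil u).trans (h2 _)⟩
  induction l with
  | nil => exact ⟨by simp [idSub], [], substApply_idSub⟩
  | cons τ l ih =>
    obtain ⟨h1, l', h2⟩ := ih fun τ hτ => hl τ (List.mem_cons_of_mem _ hτ)
    obtain ⟨g, rfl⟩ := exists_gen (hl τ List.mem_cons_self)
    refine ⟨compSub_ne_nil g.sub_ne_nil h1, g :: l', fun u => ?_⟩
    rw [List.foldr_cons, substApply_compSub g.sub_ne_nil h1, h2]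
    rfl

/-- Main theorem: the value of `𝓛(m)` for every `m ∈ (1,2]`. -/
theorem main_L_formula (m : ℝ) (hm : m ∈ Set.Ioc (1 : ℝ) 2) :
    (∀ σ ∈ LMRstar,
      m ∈ Set.Icc (muVal (substApply (compSub σ Msub) w10bar))
        (muVal (substApply (compSub σ Msub) w010bar)) →
      Lval m = gVal (substApply (compSub σ Msub) w10bar) m) ∧
    (∀ σ ∈ LMRstar,
      m ∈ Set.Icc (muVal (substApply (compSub σ Msub) w101bar))
        (muVal (substApply (compSub σ Msub) w01bar)) →
      Lval m = fVal (substApply (compSub σ Msub) w01bar) m) ∧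
    (m ∈ Set.Icc (muVal w01bar) 2 → Lval m = gVal w01bar m) ∧
    (∀ u ∈ Sset, m = muVal u → Lval m = fVal u m) := by
  obtain ⟨h1, h2⟩ := hm
  refine ⟨fun σ hσ h => ?_, fun σ hσ h => ?_, fun h => ?_, fun u hu h => ?_⟩
  · obtain ⟨l, hl⟩ := exists_acts_eq hσ
    have e := extremal_w10bar.acts l
    have e' := extremal_w010bar.acts l
    rw [hl, hl, muVal_eq, muVal_eq, e.infO_eq, e.supO_eq, e'.infO_eq, e'.supO_eq] at h
    rw [hl, gVal_eq, e.infO_eq]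
    exact Lval_eq_gv l h1 h2 h.1 h.2
  · obtain ⟨l, hl⟩ := exists_acts_eq hσ
    have e := extremal_w01bar.acts l
    have e' := extremal_w101bar.acts l
    rw [hl, hl, muVal_eq, muVal_eq, e.infO_eq, e.supO_eq, e'.infO_eq, e'.supO_eq] at h
    rw [hl, fVal_eq, e.supO_eq]
    exact Lval_eq_fv l h1 h2 h.1 h.2
  · rw [muVal_eq, infO_w01bar, supO_w01bar] at h
    rw [gVal_eq, infO_w01bar]
    exact Lval_eq_gv_w01bar h1 h2 h.1
  · rw [h, muVal_eq, fVal_eq]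
    exact Lval_eq_fv_limit hu
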